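/- (Scaling of gradient components) There exists C(L) depending only on L such that for all sufficiently small h > 0 and all φ ∈ V_h¹ ∪ V_h²: (i) ‖(∇φ)_{rθ}‖² ≤ C(L)h^{−3/2}‖e(φ)‖², (ii) ‖φ_{θ,z}‖² ≤ C(L)h^{−1/2}‖e(φ)‖², (iii) ‖φ_{r,z}‖² ≤ C(L)h^{−1}‖e(φ)‖², where (∇φ)_{rθ} = (φ_{r,θ} − φ_θ)/r and norms are L²(C_h). -/

import Mathlib

open Real MeasureTheory

noncomputable section

/-- r-partial derivative of a function on (r,θ,z)-space. -/
def dr (f : ℝ × ℝ × ℝ → ℝ) (q : ℝ × ℝ × ℝ) : ℝ := fderiv ℝ f q (1, 0, 0)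

/-- θ-partial derivative. -/
def dth (f : ℝ × ℝ × ℝ → ℝ) (q : ℝ × ℝ × ℝ) : ℝ := fderiv ℝ f q (0, 1, 0)

/-- z-partial derivative. -/
def dz (f : ℝ × ℝ × ℝ → ℝ) (q : ℝ × ℝ × ℝ) : ℝ := fderiv ℝ f q (0, 0, 1)

/-- The cylindrical shell C_h (in cylindrical coordinates, with θ ∈ [0,2π]). -/
def shell (h L : ℝ) : Set (ℝ × ℝ × ℝ) :=
  Set.Icc (1 - h/2) (1 + h/2) ×ˢ Set.Icc 0 (2*π) ×ˢ Set.Icc 0 L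

/-- 2π-periodicity in θ. -/
def Periodic3 (f : ℝ × ℝ × ℝ → ℝ) : Prop :=
  ∀ q : ℝ × ℝ × ℝ, f (q.1, q.2.1 + 2*π, q.2.2) = f q

/-- Squared Frobenius norm of the gradient in cylindrical coordinates. -/
def gradSq (fr fθ fz : ℝ × ℝ × ℝ → ℝ) (q : ℝ × ℝ × ℝ) : ℝ :=
  (dr fr q)^2 + ((dth fr q - fθ q)/q.1)^2 + (dz fr q)^2 +
  (dr fθ q)^2 + ((dth fθ q + fr q)/q.1)^2 + (dz fθ q)^2 +
  (dr fz q)^2 + (dth fz q / q.1)^2 + (dz fz q)^2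

/-- Squared Frobenius norm of the symmetrized gradient in cylindrical coordinates. -/
def eSq (fr fθ fz : ℝ × ℝ × ℝ → ℝ) (q : ℝ × ℝ × ℝ) : ℝ :=
  (dr fr q)^2 + ((dth fθ q + fr q)/q.1)^2 + (dz fz q)^2 +
  2*((dr fθ q + (dth fr q - fθ q)/q.1)/2)^2 +
  2*((dz fr q + dr fz q)/2)^2 +
  2*((dz fθ q + dth fz q / q.1)/2)^2

/-- Squared Frobenius norm of the modified gradient matrix A (1/r factors removed). -/
def ASq (fr fθ fz : ℝ × ℝ × ℝ → ℝ) (q : ℝ × ℝ × ℝ) : ℝ :=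
  (dr fr q)^2 + (dth fr q - fθ q)^2 + (dz fr q)^2 +
  (dr fθ q)^2 + (dth fθ q + fr q)^2 + (dz fθ q)^2 +
  (dr fz q)^2 + (dth fz q)^2 + (dz fz q)^2

/-- Squared Frobenius norm of A_sym = (A + Aᵀ)/2. -/
def AsymSq (fr fθ fz : ℝ × ℝ × ℝ → ℝ) (q : ℝ × ℝ × ℝ) : ℝ :=
  (dr fr q)^2 + (dth fθ q + fr q)^2 + (dz fz q)^2 +
  2*((dr fθ q + dth fr q - fθ q)/2)^2 +
  2*((dz fr q + dr fz q)/2)^2 +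
  2*((dz fθ q + dth fz q)/2)^2

/-- Boundary conditions of the space V_h¹: φ = 0 at z = 0, φ_r = φ_θ = 0 at z = L. -/
def BC1 (L : ℝ) (fr fθ fz : ℝ × ℝ × ℝ → ℝ) : Prop :=
  ∀ r θ : ℝ, fr (r, θ, 0) = 0 ∧ fθ (r, θ, 0) = 0 ∧ fz (r, θ, 0) = 0 ∧
    fr (r, θ, L) = 0 ∧ fθ (r, θ, L) = 0

/-- Boundary conditions of the space V_h²: φ_θ = φ_z = 0 at z = 0 and z = L. -/
def BC2 (L : ℝ) (fr fθ fz : ℝ × ℝ × ℝ → ℝ) : Prop :=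
  ∀ r θ : ℝ, fθ (r, θ, 0) = 0 ∧ fz (r, θ, 0) = 0 ∧
    fθ (r, θ, L) = 0 ∧ fz (r, θ, L) = 0


/-! ### Directional derivatives of smooth functions -/

/-- Derivative of `f` in the constant direction `e`. -/
def dd (e : ℝ × ℝ × ℝ) (f : ℝ × ℝ × ℝ → ℝ) (q : ℝ × ℝ × ℝ) : ℝ := fderiv ℝ f q e

/-- The coordinate direction `r`. -/
abbrev er : ℝ × ℝ × ℝ := (1, 0, 0)

/-- The coordinate direction `θ`. -/
abbrev et : ℝ × ℝ × ℝ := (0, 1, 0)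

/-- The coordinate direction `z`. -/
abbrev ez : ℝ × ℝ × ℝ := (0, 0, 1)

/-- Smooth real functions on `(r,θ,z)`-space. -/
abbrev Smooth (f : ℝ × ℝ × ℝ → ℝ) : Prop := ContDiff ℝ (⊤ : ℕ∞) f

section Derivatives

variable {f g : ℝ × ℝ × ℝ → ℝ} {e e' : ℝ × ℝ × ℝ}

theorem Smooth.cont (hf : Smooth f) : Continuous f := ContDiff.continuous hf

theorem Smooth.diff (hf : Smooth f) (q : ℝ × ℝ × ℝ) : DifferentiableAt ℝ f q :=
  (ContDiff.differentiable hf (by simp)).differentiableAt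

theorem Smooth.dd (hf : Smooth f) (e : ℝ × ℝ × ℝ) : Smooth (dd e f) :=
  (ContDiff.fderiv_right (m := (⊤ : ℕ∞)) hf (by simp)).clm_apply contDiff_const

theorem dd_add (hf : Smooth f) (hg : Smooth g) (q : ℝ × ℝ × ℝ) :
    dd e (fun q => f q + g q) q = dd e f q + dd e g q := by
  simp [dd, fderiv_fun_add (hf.diff q) (hg.diff q)]

theorem dd_sub (hf : Smooth f) (hg : Smooth g) (q : ℝ × ℝ × ℝ) :
    dd e (fun q => f q - g q) q = dd e f q - dd e g q := by
  simp [dd, fderiv_fun_sub (hf.diff q) (hg.diff q)]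

theorem dd_neg (q : ℝ × ℝ × ℝ) :
    dd e (fun q => -f q) q = -dd e f q := by
  simp [dd, fderiv_fun_neg]

theorem dd_mul (hf : Smooth f) (hg : Smooth g) (q : ℝ × ℝ × ℝ) :
    dd e (fun q => f q * g q) q = dd e f q * g q + f q * dd e g q := by
  simp [dd, fderiv_fun_mul (hf.diff q) (hg.diff q)]; ring

theorem dd_const_mul (c : ℝ) (hf : Smooth f) (q : ℝ × ℝ × ℝ) :
    dd e (fun q => c * f q) q = c * dd e f q := by
  simp [dd, fderiv_const_mul (hf.diff q)]

theorem dd_comm (hf : Smooth f) : dd e (dd e' f) = dd e' (dd e f) := by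
  have key : ∀ a b q, dd a (dd b f) q = fderiv ℝ (fderiv ℝ f) q a b := by
    intro a b q
    have h : DifferentiableAt ℝ (fderiv ℝ f) q :=
      ((ContDiff.fderiv_right (m := (⊤ : ℕ∞)) hf (by simp)).differentiable
        (by simp)).differentiableAt
    unfold dd
    rw [fderiv_clm_apply h (differentiableAt_const b)]
    simp
  funext q
  rw [key, key]
  exact (ContDiffAt.isSymmSndFDerivAt (ContDiff.contDiffAt hf)
    (by simpa using WithTop.coe_le_coe.2 (le_top : (2 : ℕ∞) ≤ ⊤))).eq e e'

/-- A function of `r` alone, viewed on `(r,θ,z)`-space. -/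
theorem dd_fst_affine (c d : ℝ) (q : ℝ × ℝ × ℝ) :
    dd e (fun q => c * q.1 + d) q = c * e.1 := by
  have h : HasFDerivAt (fun q : ℝ × ℝ × ℝ => c * q.1 + d)
      (c • ContinuousLinearMap.fst ℝ ℝ (ℝ × ℝ)) q :=
    ((hasFDerivAt_fst).const_mul c).add_const d
  simp [dd, h.fderiv]

theorem Smooth.fst_affine (c d : ℝ) : Smooth (fun q => c * q.1 + d) := by
  unfold Smooth; fun_prop

/-- Composition with an affine map in `r`. -/
def rsub (c d : ℝ) (f : ℝ × ℝ × ℝ → ℝ) (q : ℝ × ℝ × ℝ) : ℝ := f (c * q.1 + d, q.2)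

theorem Smooth.rsub (hf : Smooth f) (c d : ℝ) : Smooth (rsub c d f) := by
  unfold Smooth _root_.rsub
  exact ContDiff.comp hf (by fun_prop)

theorem dd_rsub (hf : Smooth f) (c d : ℝ) (q : ℝ × ℝ × ℝ) :
    dd e (rsub c d f) q = fderiv ℝ f (c * q.1 + d, q.2) (c * e.1, e.2) := by
  have h : HasFDerivAt (fun q : ℝ × ℝ × ℝ => (c * q.1 + d, q.2))
      ((c • ContinuousLinearMap.fst ℝ ℝ (ℝ × ℝ)).prod (ContinuousLinearMap.snd ℝ ℝ (ℝ × ℝ))) q :=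
    (((hasFDerivAt_fst).const_mul c).add_const d).prodMk hasFDerivAt_snd
  have h2 := (hf.diff (c * q.1 + d, q.2)).hasFDerivAt.comp q h
  have h3 : fderiv ℝ (_root_.rsub c d f) q = _ := h2.fderiv
  simp [dd, h3]

theorem dd_rsub_er (hf : Smooth f) (c d : ℝ) (q : ℝ × ℝ × ℝ) :
    dd er (rsub c d f) q = c * rsub c d (dd er f) q := by
  rw [dd_rsub hf]
  have : ((c * er.1, er.2) : ℝ × ℝ × ℝ) = c • er := by simp
  rw [this, map_smul]; rfl

theorem dd_rsub_of_fst (hf : Smooth f) (he : e.1 = 0) (c d : ℝ) (q : ℝ × ℝ × ℝ) :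
    dd e (rsub c d f) q = rsub c d (dd e f) q := by
  rw [dd_rsub hf]
  have : ((c * e.1, e.2) : ℝ × ℝ × ℝ) = e := by rw [he, mul_zero, ← he]
  rw [this]; rfl

/-- Translation by `t` in `θ`. -/
def shift (t : ℝ) (f : ℝ × ℝ × ℝ → ℝ) (q : ℝ × ℝ × ℝ) : ℝ := f (q.1, q.2.1 + t, q.2.2)

theorem Smooth.shift (hf : Smooth f) (t : ℝ) : Smooth (shift t f) := by
  unfold Smooth _root_.shift
  exact ContDiff.comp hf (by fun_prop)

theorem dd_shift (t : ℝ) (q : ℝ × ℝ × ℝ) :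
    dd e (shift t f) q = shift t (dd e f) q := by
  have h : shift t f = fun q => f (q + (0, t, 0)) := by
    funext q; obtain ⟨a, b, c⟩ := q; simp [shift]
  unfold dd
  rw [h, fderiv_comp_add_right]
  obtain ⟨a, b, c⟩ := q; simp [shift]

theorem Periodic3.dd (hf : Periodic3 f) (e : ℝ × ℝ × ℝ) : Periodic3 (dd e f) := by
  intro q
  have h : _root_.shift (2 * π) f = f := funext hf
  have := dd_shift (e := e) (f := f) (2 * π) q
  rw [h] at this
  exact this.symm

theorem Periodic3.shift (hf : Periodic3 f) (t : ℝ) : Periodic3 (shift t f) := by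
  intro q
  have := hf (q.1, q.2.1 + t, q.2.2)
  simp only [_root_.shift] at this ⊢
  rw [← this]; congr 3; ring

theorem Periodic3.rsub (hf : Periodic3 f) (c d : ℝ) : Periodic3 (rsub c d f) :=
  fun q => hf (c * q.1 + d, q.2)

theorem Smooth.hasDerivAt_r (hf : Smooth f) (r θ z : ℝ) :
    HasDerivAt (fun r => f (r, θ, z)) (_root_.dd er f (r, θ, z)) r := by
  have h : HasDerivAt (fun r : ℝ => ((r, θ, z) : ℝ × ℝ × ℝ)) er r :=
    (hasDerivAt_id r).prodMk (hasDerivAt_const r ((θ, z) : ℝ × ℝ))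
  exact (hf.diff (r, θ, z)).hasFDerivAt.comp_hasDerivAt r h

theorem Smooth.hasDerivAt_t (hf : Smooth f) (r θ z : ℝ) :
    HasDerivAt (fun θ => f (r, θ, z)) (_root_.dd et f (r, θ, z)) θ := by
  have h : HasDerivAt (fun θ : ℝ => ((r, θ, z) : ℝ × ℝ × ℝ)) et θ :=
    (hasDerivAt_const θ r).prodMk ((hasDerivAt_id θ).prodMk (hasDerivAt_const θ z))
  exact (hf.diff (r, θ, z)).hasFDerivAt.comp_hasDerivAt θ h

theorem Smooth.hasDerivAt_z (hf : Smooth f) (r θ z : ℝ) :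
    HasDerivAt (fun z => f (r, θ, z)) (_root_.dd ez f (r, θ, z)) z := by
  have h : HasDerivAt (fun z : ℝ => ((r, θ, z) : ℝ × ℝ × ℝ)) ez z :=
    (hasDerivAt_const z r).prodMk ((hasDerivAt_const z θ).prodMk (hasDerivAt_id z))
  exact (hf.diff (r, θ, z)).hasFDerivAt.comp_hasDerivAt z h

/-- `f` vanishes on the planes `z = 0` and `z = L`. -/
def VanZ (L : ℝ) (f : ℝ × ℝ × ℝ → ℝ) : Prop := ∀ r θ : ℝ, f (r, θ, 0) = 0 ∧ f (r, θ, L) = 0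

theorem VanZ.mul_left {L : ℝ} (hf : VanZ L f) (g : ℝ × ℝ × ℝ → ℝ) :
    VanZ L (fun q => f q * g q) := fun r θ => by simp [hf r θ]

theorem VanZ.mul_right {L : ℝ} (hf : VanZ L f) (g : ℝ × ℝ × ℝ → ℝ) :
    VanZ L (fun q => g q * f q) := fun r θ => by simp [hf r θ]

theorem VanZ.dd {L : ℝ} (hv : VanZ L f) (hf : Smooth f) (he : e.2.2 = 0) : VanZ L (dd e f) := by
  have key : ∀ z, (∀ r θ, f (r, θ, z) = 0) → ∀ r θ, _root_.dd e f (r, θ, z) = 0 := by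
    intro z hz r θ
    have h : HasDerivAt (fun t : ℝ => ((r, θ, z) : ℝ × ℝ × ℝ) + t • e) e 0 := by
      simpa using ((hasDerivAt_id (0 : ℝ)).smul_const e).const_add (r, θ, z)
    have hq : ((r, θ, z) : ℝ × ℝ × ℝ) + (0 : ℝ) • e = (r, θ, z) := by simp
    have h2 := (hf.diff (((r, θ, z) : ℝ × ℝ × ℝ) + (0 : ℝ) • e)).hasFDerivAt.comp_hasDerivAt
      (0 : ℝ) h
    have h3 : (f ∘ fun t : ℝ => ((r, θ, z) : ℝ × ℝ × ℝ) + t • e) = fun _ => 0 := by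
      funext t
      obtain ⟨e1, e2, e3⟩ := e
      simp only at he
      subst he
      simpa using hz (r + t * e1) (θ + t * e2)
    rw [h3, hq] at h2
    exact h2.unique (hasDerivAt_const _ _)
  exact fun r θ => ⟨key 0 (fun r θ => (hv r θ).1) r θ, key L (fun r θ => (hv r θ).2) r θ⟩

theorem VanZ.rsub {L : ℝ} (hf : VanZ L f) (c d : ℝ) : VanZ L (rsub c d f) :=
  fun r θ => hf (c * r + d) θ

theorem VanZ.shift {L : ℝ} (hf : VanZ L f) (t : ℝ) : VanZ L (shift t f) :=
  fun r θ => hf r (θ + t)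

end Derivatives

/-! ### Integrals over boxes -/

/-- The box `[a,b] × [0,2π] × [0,L]`. -/
def box (L a b : ℝ) : Set (ℝ × ℝ × ℝ) := Set.Icc a b ×ˢ Set.Icc 0 (2 * π) ×ˢ Set.Icc 0 L

/-- The integral over a box. -/
def boxInt (L a b : ℝ) (f : ℝ × ℝ × ℝ → ℝ) : ℝ := ∫ q in box L a b, f q

theorem isCompact_box (L a b : ℝ) : IsCompact (box L a b) :=
  isCompact_Icc.prod (isCompact_Icc.prod isCompact_Icc)

theorem measurableSet_box (L a b : ℝ) : MeasurableSet (box L a b) :=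
  (isCompact_box L a b).measurableSet

section BoxIntegral

variable {L a b : ℝ} {f g : ℝ × ℝ × ℝ → ℝ}

theorem integrableOn_box (hf : Continuous f) : IntegrableOn f (box L a b) :=
  hf.continuousOn.integrableOn_compact (isCompact_box L a b)

theorem boxInt_add (hf : Continuous f) (hg : Continuous g) :
    boxInt L a b (fun q => f q + g q) = boxInt L a b f + boxInt L a b g :=
  integral_add (integrableOn_box hf) (integrableOn_box hg)

theorem boxInt_sub (hf : Continuous f) (hg : Continuous g) :
    boxInt L a b (fun q => f q - g q) = boxInt L a b f - boxInt L a b g :=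
  integral_sub (integrableOn_box hf) (integrableOn_box hg)

theorem boxInt_const_mul (c : ℝ) : boxInt L a b (fun q => c * f q) = c * boxInt L a b f :=
  integral_const_mul c f

theorem boxInt_neg : boxInt L a b (fun q => -f q) = -boxInt L a b f :=
  integral_neg f

theorem boxInt_mono (hf : Continuous f) (hg : Continuous g)
    (h : ∀ q ∈ box L a b, f q ≤ g q) : boxInt L a b f ≤ boxInt L a b g :=
  setIntegral_mono_on (integrableOn_box hf) (integrableOn_box hg) (measurableSet_box L a b) h

theorem boxInt_nonneg (h : ∀ q ∈ box L a b, 0 ≤ f q) : 0 ≤ boxInt L a b f :=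
  setIntegral_nonneg (measurableSet_box L a b) h

/-- Fubini for a continuous function on a rectangle. -/
theorem setIntegral_rect {X Y : Type*} [TopologicalSpace X] [TopologicalSpace Y]
    [MeasureSpace X] [MeasureSpace Y] [OpensMeasurableSpace X] [OpensMeasurableSpace Y]
    [T2Space X] [T2Space Y] [SecondCountableTopology X] [SecondCountableTopology Y]
    [IsFiniteMeasureOnCompacts (volume : Measure X)]
    [IsFiniteMeasureOnCompacts (volume : Measure Y)]
    [SigmaFinite (volume : Measure X)] [SigmaFinite (volume : Measure Y)]
    {s : Set X} {t : Set Y} (hs : IsCompact s) (ht : IsCompact t) {F : X × Y → ℝ}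
    (hF : Continuous F) :
    (∫ q in s ×ˢ t, F q) = ∫ x in s, ∫ y in t, F (x, y) ∧
      (∫ q in s ×ˢ t, F q) = ∫ y in t, ∫ x in s, F (x, y) := by
  have hI : IntegrableOn F (s ×ˢ t) ((volume : Measure X).prod volume) :=
    hF.continuousOn.integrableOn_compact (hs.prod ht)
  refine ⟨setIntegral_prod F hI, ?_⟩
  have hI' : Integrable F (((volume : Measure X).restrict s).prod ((volume : Measure Y).restrict t)) := by
    rw [Measure.prod_restrict]; exact hI
  have := integral_prod_symm F hI'
  rw [Measure.prod_restrict] at this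
  exact this

theorem setIntegral_Icc_eq {a b : ℝ} (hab : a ≤ b) (F : ℝ → ℝ) :
    (∫ x in Set.Icc a b, F x) = ∫ x in a..b, F x := by
  rw [integral_Icc_eq_integral_Ioc, intervalIntegral.integral_of_le hab]

theorem boxInt_iter (hf : Continuous f) :
    boxInt L a b f =
      ∫ r in Set.Icc a b, ∫ θ in Set.Icc 0 (2 * π), ∫ z in Set.Icc 0 L, f (r, θ, z) := by
  unfold boxInt box
  rw [(setIntegral_rect isCompact_Icc (isCompact_Icc.prod isCompact_Icc) hf).1]
  congr 1; funext r
  exact (setIntegral_rect isCompact_Icc isCompact_Icc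
    (hf.comp (Continuous.prodMk_right r))).1

theorem boxInt_iter_t (hf : Continuous f) :
    boxInt L a b f =
      ∫ r in Set.Icc a b, ∫ z in Set.Icc 0 L, ∫ θ in Set.Icc 0 (2 * π), f (r, θ, z) := by
  unfold boxInt box
  rw [(setIntegral_rect isCompact_Icc (isCompact_Icc.prod isCompact_Icc) hf).1]
  congr 1; funext r
  exact (setIntegral_rect isCompact_Icc isCompact_Icc
    (hf.comp (Continuous.prodMk_right r))).2

theorem boxInt_iter_r (hf : Continuous f) :
    boxInt L a b f =
      ∫ p in Set.Icc 0 (2 * π) ×ˢ Set.Icc 0 L, ∫ r in Set.Icc a b, f (r, p) := by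
  unfold boxInt box
  exact (setIntegral_rect isCompact_Icc (isCompact_Icc.prod isCompact_Icc) hf).2

/-- Slices of constant `r`, integrated over `(θ,z)`. -/
def sliceInt (L : ℝ) (f : ℝ × ℝ × ℝ → ℝ) (r : ℝ) : ℝ :=
  ∫ p in Set.Icc 0 (2 * π) ×ˢ Set.Icc 0 L, f (r, p)

theorem boxInt_slice (hf : Continuous f) (hab : a ≤ b) :
    boxInt L a b f = ∫ r in a..b, sliceInt L f r := by
  rw [← setIntegral_Icc_eq hab]
  unfold boxInt box
  exact (setIntegral_rect isCompact_Icc (isCompact_Icc.prod isCompact_Icc) hf).1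

theorem boxInt_dz (hf : Smooth f) (hv : VanZ L f) (hL : 0 ≤ L) :
    boxInt L a b (dd ez f) = 0 := by
  rw [boxInt_iter (hf.dd ez).cont]
  have : ∀ r θ, ∫ z in Set.Icc 0 L, dd ez f (r, θ, z) = 0 := by
    intro r θ
    have hc : Continuous fun z => dd ez f (r, θ, z) := (hf.dd ez).cont.comp (by fun_prop)
    rw [setIntegral_Icc_eq hL, intervalIntegral.integral_eq_sub_of_hasDerivAt
      (fun z _ => hf.hasDerivAt_z r θ z) (hc.intervalIntegrable _ _), (hv r θ).1, (hv r θ).2,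
      sub_zero]
  simp [this]

theorem boxInt_dt (hf : Smooth f) (hp : Periodic3 f) :
    boxInt L a b (dd et f) = 0 := by
  rw [boxInt_iter_t (hf.dd et).cont]
  have : ∀ r z, ∫ θ in Set.Icc 0 (2 * π), dd et f (r, θ, z) = 0 := by
    intro r z
    have hc : Continuous fun θ => dd et f (r, θ, z) := (hf.dd et).cont.comp (by fun_prop)
    have := hp (r, 0, z)
    simp only [zero_add] at this
    rw [setIntegral_Icc_eq two_pi_pos.le, intervalIntegral.integral_eq_sub_of_hasDerivAt
      (fun θ _ => hf.hasDerivAt_t r θ z) (hc.intervalIntegrable _ _), this, sub_self]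
  simp [this]

theorem boxInt_dr (hf : Smooth f) (hab : a ≤ b) :
    boxInt L a b (dd er f) = sliceInt L f b - sliceInt L f a := by
  rw [boxInt_iter_r (hf.dd er).cont]
  have key : ∀ p : ℝ × ℝ, ∫ r in Set.Icc a b, dd er f (r, p) = f (b, p) - f (a, p) := by
    intro p
    have hc : Continuous fun r => dd er f (r, p) := (hf.dd er).cont.comp (by fun_prop)
    rw [setIntegral_Icc_eq hab, intervalIntegral.integral_eq_sub_of_hasDerivAt
      (fun r _ => hf.hasDerivAt_r r p.1 p.2) (hc.intervalIntegrable _ _)]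
  simp only [key]
  have hK : IsCompact (Set.Icc 0 (2 * π) ×ˢ Set.Icc 0 L) := isCompact_Icc.prod isCompact_Icc
  exact integral_sub
    ((hf.cont.comp (Continuous.prodMk_right b)).continuousOn.integrableOn_compact hK)
    ((hf.cont.comp (Continuous.prodMk_right a)).continuousOn.integrableOn_compact hK)

theorem boxInt_rsub (hf : Continuous f) {c d : ℝ} (hc : 0 < c) (hab : a ≤ b) :
    boxInt L a b (rsub c d f) = c⁻¹ * boxInt L (c * a + d) (c * b + d) f := by
  have hr : Continuous (rsub c d f) := by
    unfold rsub; exact hf.comp (by fun_prop)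
  have h : sliceInt L (rsub c d f) = fun r => sliceInt L f (c * r + d) := rfl
  rw [boxInt_slice hr hab, boxInt_slice hf (by nlinarith), h,
    intervalIntegral.integral_comp_mul_add _ hc.ne' d, smul_eq_mul]

theorem boxInt_reflect (hf : Continuous f) (hab : a ≤ b) :
    boxInt L a b (rsub (-1) (a + b) f) = boxInt L a b f := by
  have hr : Continuous (rsub (-1) (a + b) f) := by
    unfold rsub; exact hf.comp (by fun_prop)
  have h : sliceInt L (rsub (-1) (a + b) f) = fun r => sliceInt L f (-1 * r + (a + b)) := rfl
  rw [boxInt_slice hr hab, boxInt_slice hf hab, h,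
    intervalIntegral.integral_comp_mul_add _ (by norm_num) (a + b), smul_eq_mul]
  rw [intervalIntegral.integral_symm]
  ring_nf

theorem boxInt_shift (hf : Continuous f) (hp : Periodic3 f) (t : ℝ) :
    boxInt L a b (shift t f) = boxInt L a b f := by
  have hr : Continuous (shift t f) := by
    unfold shift; exact hf.comp (by fun_prop)
  rw [boxInt_iter_t hr, boxInt_iter_t hf]
  congr 1; funext r; congr 1; funext z
  rw [setIntegral_Icc_eq two_pi_pos.le, setIntegral_Icc_eq two_pi_pos.le]
  have hper : Function.Periodic (fun θ => f (r, θ, z)) (2 * π) := fun θ => hp (r, θ, z)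
  have h1 := intervalIntegral.integral_comp_add_right (a := 0) (b := 2 * π)
    (fun θ => f (r, θ, z)) t
  have h2 := hper.intervalIntegral_add_eq t 0
  simp only [zero_add] at h1 h2
  rw [add_comm t] at h2
  exact h1.trans h2

end BoxIntegral

/-! ### Korn's inequality in a thin strip -/

/-- Boundary conditions allowing integration by parts in the direction `e`: periodicity for
`e = et`, and vanishing of one of the two functions on the planes `z = 0`, `z = L` for `e = ez`. -/
def Adm (L : ℝ) (e : ℝ × ℝ × ℝ) (u w : ℝ × ℝ × ℝ → ℝ) : Prop :=
  (e = et ∧ Periodic3 u ∧ Periodic3 w) ∨ (e = ez ∧ (VanZ L u ∨ VanZ L w))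

section Strip

variable {L a h η κ : ℝ} {e : ℝ × ℝ × ℝ} {u w g : ℝ × ℝ × ℝ → ℝ}

theorem Adm.fst_eq (hA : Adm L e u w) : e.1 = 0 := by
  rcases hA with ⟨rfl, _⟩ | ⟨rfl, _⟩ <;> rfl

/-- A linear cutoff, equal to `1` at `r = a` and to `0` at `r = a + h`. -/
def cutoff (a h : ℝ) (q : ℝ × ℝ × ℝ) : ℝ := -h⁻¹ * q.1 + (1 + h⁻¹ * a)

theorem smooth_cutoff : Smooth (cutoff a h) := Smooth.fst_affine _ _

theorem cutoff_mem (hh : 0 < h) {q : ℝ × ℝ × ℝ} (hq : q ∈ box L a (a + h)) :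
    0 ≤ cutoff a h q ∧ cutoff a h q ≤ 1 := by
  have h1 := hq.1.1
  have h2 := hq.1.2
  have e1 : cutoff a h q = 1 - (q.1 - a) / h := by unfold cutoff; field_simp; ring
  rw [e1]
  constructor
  · have : (q.1 - a) / h ≤ 1 := by rw [div_le_one hh]; linarith
    linarith
  · have : 0 ≤ (q.1 - a) / h := div_nonneg (by linarith) hh.le
    linarith

theorem boxInt_adm (hL : 0 ≤ L) (hA : Adm L e u w) (hu : Smooth u) (hw : Smooth w) (b c : ℝ) :
    boxInt L b c (dd e (fun q => (cutoff a h q * u q) * dd er w q)) = 0 := by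
  have hs : Smooth (fun q => (cutoff a h q * u q) * dd er w q) :=
    ContDiff.mul (ContDiff.mul smooth_cutoff hu) (hw.dd er)
  rcases hA with ⟨rfl, pu, pw⟩ | ⟨rfl, hv⟩
  · refine boxInt_dt hs fun q => ?_
    have h1 := pu q
    have h2 := pw.dd er q
    rw [h1, h2]; rfl
  · refine boxInt_dz hs ?_ hL
    rcases hv with hv | hv
    · exact (hv.mul_right _).mul_left _
    · exact (hv.dd hw rfl).mul_right _

theorem strip_identity (hL : 0 ≤ L) (hh : 0 < h) (hA : Adm L e u w) (hu : Smooth u)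
    (hw : Smooth w) (hg : Smooth g) :
    boxInt L a (a + h) (fun q => cutoff a h q * (dd e u q * dd er w q
        - dd er u q * (dd e w q + g q) - u q * dd er g q) + h⁻¹ * (u q * (dd e w q + g q)))
      = sliceInt L (fun q => u q * (dd e w q + g q)) a := by
  have hQ : Smooth (fun q => dd e w q + g q) := ContDiff.add (hw.dd e) hg
  have hcu : Smooth (fun q => cutoff a h q * u q) := ContDiff.mul smooth_cutoff hu
  have hF1 : Smooth (fun q => (cutoff a h q * u q) * dd er w q) := ContDiff.mul hcu (hw.dd er)
  have hF2 : Smooth (fun q => (cutoff a h q * u q) * (dd e w q + g q)) := ContDiff.mul hcu hQ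
  have h1 := boxInt_adm (a := a) (h := h) hL hA hu hw a (a + h)
  have h2 := boxInt_dr (L := L) (a := a) (b := a + h) hF2 (by linarith)
  have s1 : sliceInt L (fun q => (cutoff a h q * u q) * (dd e w q + g q)) (a + h) = 0 := by
    have : cutoff a h = fun q => 1 - (q.1 - a) / h := by
      funext q; unfold cutoff; field_simp; ring
    simp [sliceInt, this, hh.ne']
  have s2 : sliceInt L (fun q => (cutoff a h q * u q) * (dd e w q + g q)) a
      = sliceInt L (fun q => u q * (dd e w q + g q)) a := by
    have : cutoff a h = fun q => 1 - (q.1 - a) / h := by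
      funext q; unfold cutoff; field_simp; ring
    simp [sliceInt, this]
  have h3 := boxInt_sub (L := L) (a := a) (b := a + h) (hF1.dd e).cont (hF2.dd er).cont
  rw [h1, h2, s1, s2] at h3
  rw [show sliceInt L (fun q => u q * (dd e w q + g q)) a
    = 0 - (0 - sliceInt L (fun q => u q * (dd e w q + g q)) a) by ring, ← h3]
  congr 1
  funext q
  rw [dd_mul hcu (hw.dd er), dd_mul hcu hQ, dd_mul smooth_cutoff hu, dd_mul smooth_cutoff hu,
    dd_add (hw.dd e) hg, dd_comm hw]
  unfold cutoff
  rw [dd_fst_affine, dd_fst_affine, hA.fst_eq]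
  simp only [er]
  ring

/-- The density controlling the tangential shear in a strip. -/
def stripDensity (h η κ : ℝ) (e : ℝ × ℝ × ℝ) (u w : ℝ × ℝ × ℝ → ℝ) (q : ℝ × ℝ × ℝ) : ℝ :=
  (dd e u q + dd er w q) ^ 2 + dd er u q ^ 2 + (dd e w q + κ * u q) ^ 2 + η * u q ^ 2
    + (dd er u q ^ 2 + (dd e w q + κ * u q) ^ 2) / (h ^ 2 * η)

theorem continuous_stripDensity (hu : Smooth u) (hw : Smooth w) :
    Continuous (stripDensity h η κ e u w) := by
  have h1 := (hu.dd e).cont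
  have h2 := (hw.dd e).cont
  have h3 := (hu.dd er).cont
  have h4 := (hw.dd er).cont
  have h5 := hu.cont
  unfold stripDensity
  fun_prop

theorem stripDensity_nonneg (hη : 0 < η) (q : ℝ × ℝ × ℝ) :
    0 ≤ stripDensity h η κ e u w q := by
  unfold stripDensity; positivity

theorem strip_pointwise_upper {c t p Q v W : ℝ} (hc0 : 0 ≤ c) (hc1 : c ≤ 1) (hh : 0 < h)
    (hh1 : h ≤ 1) (hη : 0 < η) (hκ : κ ^ 2 ≤ 1) :
    c * ((t - W) * W - p * Q - v * (κ * p)) + h⁻¹ * (v * Q) ≤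
      -(1 / 2) * (c * W ^ 2) +
        (t ^ 2 + p ^ 2 + Q ^ 2 + η * v ^ 2 + (p ^ 2 + Q ^ 2) / (h ^ 2 * η)) := by
  have e1 : c * ((t - W) * W) ≤ -(1 / 2) * (c * W ^ 2) + 1 / 2 * t ^ 2 := by
    nlinarith [mul_nonneg hc0 (sq_nonneg (t - W)), mul_nonneg (sub_nonneg.2 hc1) (sq_nonneg t)]
  have e2 : -(c * (p * Q)) ≤ 1 / 2 * (p ^ 2 + Q ^ 2) := by
    nlinarith [mul_nonneg hc0 (sq_nonneg (p + Q)),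
      mul_nonneg (sub_nonneg.2 hc1) (add_nonneg (sq_nonneg p) (sq_nonneg Q))]
  have hinv : 1 ≤ (h ^ 2)⁻¹ := (one_le_inv₀ (by positivity)).2 (by nlinarith)
  have e3 : -(c * (v * (κ * p))) ≤ 1 / 2 * (η * v ^ 2 + p ^ 2 / (h ^ 2 * η)) := by
    have k1 : 0 ≤ (c * κ) ^ 2 := sq_nonneg _
    have k2 : (c * κ) ^ 2 ≤ 1 := by
      rw [mul_pow]; nlinarith [sq_nonneg κ, mul_nonneg hc0 (sub_nonneg.2 hc1)]
    have k3 : 0 ≤ η * (v + (c * κ) * p / η) ^ 2 := by positivity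
    have k4 : η * (v + (c * κ) * p / η) ^ 2
        = η * v ^ 2 + 2 * (c * (v * (κ * p))) + (c * κ) ^ 2 * (p ^ 2 / η) := by
      field_simp; ring
    have k5 : (c * κ) ^ 2 * (p ^ 2 / η) ≤ p ^ 2 / (h ^ 2 * η) := by
      have : p ^ 2 / (h ^ 2 * η) = (h ^ 2)⁻¹ * (p ^ 2 / η) := by field_simp
      rw [this]
      exact mul_le_mul_of_nonneg_right (k2.trans hinv) (by positivity)
    linarith
  have e4 : h⁻¹ * (v * Q) ≤ 1 / 2 * (η * v ^ 2 + Q ^ 2 / (h ^ 2 * η)) := by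
    have k3 : 0 ≤ η * (v - Q / (h * η)) ^ 2 := by positivity
    have k4 : η * (v - Q / (h * η)) ^ 2
        = η * v ^ 2 - 2 * (h⁻¹ * (v * Q)) + Q ^ 2 / (h ^ 2 * η) := by
      field_simp; ring
    linarith
  have e5 : (p ^ 2 + Q ^ 2) / (h ^ 2 * η) = p ^ 2 / (h ^ 2 * η) + Q ^ 2 / (h ^ 2 * η) := by
    rw [add_div]
  have e6 : 0 ≤ p ^ 2 / (h ^ 2 * η) := by positivity
  have e7 : 0 ≤ Q ^ 2 / (h ^ 2 * η) := by positivity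
  rw [e5]
  nlinarith [sq_nonneg t, sq_nonneg p, sq_nonneg Q]

theorem strip_pointwise_lower {c t p Q v t' p' Q' v' W : ℝ} (hc0 : 0 ≤ c) (hc1 : c ≤ 1)
    (hh : 0 < h) (hh1 : h ≤ 1) (hη : 0 < η) (hκ : κ ^ 2 ≤ 1) :
    -64 * ((t ^ 2 + p ^ 2 + Q ^ 2 + η * v ^ 2 + (p ^ 2 + Q ^ 2) / (h ^ 2 * η)) +
        (t' ^ 2 + p' ^ 2 + Q' ^ 2 + η * v' ^ 2 + (p' ^ 2 + Q' ^ 2) / (h ^ 2 * η))) ≤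
      c * ((-3 * t + 4 * t' + W) * W - (-3 * p + 8 * p') * (3 * Q - 2 * Q')
        - (-3 * v + 4 * v') * (κ * (3 * p - 4 * p')))
        + 2 * h⁻¹ * ((-3 * v + 4 * v') * (3 * Q - 2 * Q')) := by
  have hinv : 1 ≤ (h ^ 2)⁻¹ := (one_le_inv₀ (by positivity)).2 (by nlinarith)
  have e1 : -8 * (t ^ 2 + t' ^ 2) ≤ c * ((-3 * t + 4 * t' + W) * W) := by
    have k1 : -8 * (t ^ 2 + t' ^ 2) ≤ (-3 * t + 4 * t' + W) * W := by
      nlinarith [sq_nonneg (W + (-3 * t + 4 * t') / 2), sq_nonneg (4 * t + 3 * t'), sq_nonneg t,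
        sq_nonneg t']
    have k2 : 0 ≤ t ^ 2 + t' ^ 2 := by positivity
    nlinarith [mul_le_mul_of_nonneg_left k1 hc0, mul_nonneg (sub_nonneg.2 hc1) k2]
  have e2 : c * ((-3 * p + 8 * p') * (3 * Q - 2 * Q')) ≤
      64 * (p ^ 2 + p' ^ 2 + Q ^ 2 + Q' ^ 2) := by
    have k1 : (-3 * p + 8 * p') * (3 * Q - 2 * Q') ≤ 64 * (p ^ 2 + p' ^ 2 + Q ^ 2 + Q' ^ 2) := by
      nlinarith [sq_nonneg (-3 * p + 8 * p' - (3 * Q - 2 * Q')), sq_nonneg (8 * p + 3 * p'),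
        sq_nonneg (2 * Q + 3 * Q'), sq_nonneg p, sq_nonneg p', sq_nonneg Q, sq_nonneg Q']
    have k2 : 0 ≤ p ^ 2 + p' ^ 2 + Q ^ 2 + Q' ^ 2 := by positivity
    nlinarith [mul_le_mul_of_nonneg_left k1 hc0, mul_nonneg (sub_nonneg.2 hc1) k2]
  have sqv : (-3 * v + 4 * v') ^ 2 ≤ 32 * (v ^ 2 + v' ^ 2) := by
    nlinarith [sq_nonneg (4 * v + 3 * v'), sq_nonneg v, sq_nonneg v']
  have sqp : (3 * p - 4 * p') ^ 2 ≤ 32 * (p ^ 2 + p' ^ 2) := by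
    nlinarith [sq_nonneg (4 * p + 3 * p'), sq_nonneg p, sq_nonneg p']
  have sqQ : (3 * Q - 2 * Q') ^ 2 ≤ 18 * (Q ^ 2 + Q' ^ 2) := by
    nlinarith [sq_nonneg (2 * Q + 3 * Q'), sq_nonneg Q, sq_nonneg Q']
  set V := -3 * v + 4 * v' with hV
  set P := 3 * p - 4 * p' with hP
  set R := 3 * Q - 2 * Q' with hR
  have e3 : c * (V * (κ * P)) ≤ 1 / 2 * (η * V ^ 2 + P ^ 2 / (h ^ 2 * η)) := by
    have k2 : (c * κ) ^ 2 ≤ 1 := by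
      rw [mul_pow]; nlinarith [sq_nonneg κ, mul_nonneg hc0 (sub_nonneg.2 hc1)]
    have k3 : 0 ≤ η * (V - (c * κ) * P / η) ^ 2 := by positivity
    have k4 : η * (V - (c * κ) * P / η) ^ 2
        = η * V ^ 2 - 2 * (c * (V * (κ * P))) + (c * κ) ^ 2 * (P ^ 2 / η) := by
      field_simp; ring
    have k5 : (c * κ) ^ 2 * (P ^ 2 / η) ≤ P ^ 2 / (h ^ 2 * η) := by
      have : P ^ 2 / (h ^ 2 * η) = (h ^ 2)⁻¹ * (P ^ 2 / η) := by field_simp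
      rw [this]
      exact mul_le_mul_of_nonneg_right (k2.trans hinv) (by positivity)
    linarith
  have e4 : -(2 * h⁻¹ * (V * R)) ≤ η * V ^ 2 + R ^ 2 / (h ^ 2 * η) := by
    have k3 : 0 ≤ η * (V + R / (h * η)) ^ 2 := by positivity
    have k4 : η * (V + R / (h * η)) ^ 2
        = η * V ^ 2 + 2 * h⁻¹ * (V * R) + R ^ 2 / (h ^ 2 * η) := by
      field_simp; ring
    linarith
  have d0 : 0 < h ^ 2 * η := by positivity
  have b1 : η * V ^ 2 ≤ 32 * (η * v ^ 2 + η * v' ^ 2) := by nlinarith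
  have b2 : P ^ 2 / (h ^ 2 * η) ≤ 32 * (p ^ 2 / (h ^ 2 * η) + p' ^ 2 / (h ^ 2 * η)) := by
    rw [← add_div, mul_div_assoc', div_le_div_iff_of_pos_right d0]; exact sqp
  have b3 : R ^ 2 / (h ^ 2 * η) ≤ 18 * (Q ^ 2 / (h ^ 2 * η) + Q' ^ 2 / (h ^ 2 * η)) := by
    rw [← add_div, mul_div_assoc', div_le_div_iff_of_pos_right d0]; exact sqQ
  have n1 : 0 ≤ p ^ 2 / (h ^ 2 * η) := by positivity
  have n2 : 0 ≤ p' ^ 2 / (h ^ 2 * η) := by positivity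
  have n3 : 0 ≤ Q ^ 2 / (h ^ 2 * η) := by positivity
  have n4 : 0 ≤ Q' ^ 2 / (h ^ 2 * η) := by positivity
  have n5 : 0 ≤ η * v ^ 2 := by positivity
  have n6 : 0 ≤ η * v' ^ 2 := by positivity
  rw [add_div, add_div]
  linarith [sq_nonneg t, sq_nonneg t']

theorem boxInt_half_le {f : ℝ × ℝ × ℝ → ℝ} (hf : Continuous f) (h0 : ∀ q, 0 ≤ f q)
    (hh : 0 < h) : boxInt L a (a + h / 2) f ≤ boxInt L a (a + h) f := by
  refine setIntegral_mono_set (integrableOn_box hf) (ae_of_all _ h0)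
    (LE.le.eventuallyLE ?_)
  exact Set.prod_mono (Set.Icc_subset_Icc le_rfl (by linarith)) subset_rfl

/-- Comparison with the reflected field `-3 u(s) + 4 u(2s)`, `3 w(s) - 2 w(2s)`. -/
theorem strip_half (hL : 0 ≤ L) (hh : 0 < h) (hh1 : h ≤ 1) (hη : 0 < η) (hκ : κ ^ 2 ≤ 1)
    (hA : Adm L e u w) (hu : Smooth u) (hw : Smooth w) :
    boxInt L a (a + h) (fun q => cutoff a h q * dd er w q ^ 2) ≤
      194 * boxInt L a (a + h) (stripDensity h η κ e u w) := by
  have he := hA.fst_eq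
  have hku : Smooth (fun q => κ * u q) := ContDiff.mul contDiff_const hu
  -- the reflected field
  set u' := rsub 2 (-a) u with hu'
  set w' := rsub 2 (-a) w with hw'
  have su' : Smooth u' := hu.rsub _ _
  have sw' : Smooth w' := hw.rsub _ _
  set U : ℝ × ℝ × ℝ → ℝ := fun q => -3 * u q + 4 * u' q with hU
  set W : ℝ × ℝ × ℝ → ℝ := fun q => 3 * w q - 2 * w' q with hW
  set G : ℝ × ℝ × ℝ → ℝ := fun q => κ * (3 * u q - 2 * u' q) with hG
  have cm : ∀ (c : ℝ) {f : ℝ × ℝ × ℝ → ℝ}, Smooth f → Smooth (fun q => c * f q) :=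
    fun c f hf => ContDiff.mul contDiff_const hf
  have sU : Smooth U := ContDiff.add (cm _ hu) (cm _ su')
  have sW : Smooth W := ContDiff.sub (cm _ hw) (cm _ sw')
  have sG' : Smooth (fun q => 3 * u q - 2 * u' q) := ContDiff.sub (cm _ hu) (cm _ su')
  have sG : Smooth G := cm _ sG'
  have hA' : Adm L e U W := by
    rcases hA with ⟨rfl, pu, pw⟩ | ⟨rfl, hv⟩
    · refine Or.inl ⟨rfl, fun q => ?_, fun q => ?_⟩
      · simp only [hU]; rw [pu q, show u' (q.1, q.2.1 + 2 * π, q.2.2) = u' q from (pu.rsub 2 (-a)) q]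
      · simp only [hW]; rw [pw q, show w' (q.1, q.2.1 + 2 * π, q.2.2) = w' q from (pw.rsub 2 (-a)) q]
    · refine Or.inr ⟨rfl, hv.imp (fun hv r θ => ?_) (fun hv r θ => ?_)⟩
      · have := (hv.rsub 2 (-a)) r θ
        simp [hU, hu', this, hv r θ]
      · have := (hv.rsub 2 (-a)) r θ
        simp [hW, hw', this, hv r θ]
  have id1 := strip_identity (a := a) hL hh hA hu hw hku
  have id2 := strip_identity (a := a) (h := h / 2) hL (by linarith) hA' sU sW sG
  have dU : ∀ q, dd e U q = -3 * dd e u q + 4 * rsub 2 (-a) (dd e u) q := fun q => by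
    rw [hU, dd_add (cm _ hu) (cm _ su'), dd_const_mul _ hu, dd_const_mul _ su',
      dd_rsub_of_fst hu he]
  have dW : ∀ q, dd e W q = 3 * dd e w q - 2 * rsub 2 (-a) (dd e w) q := fun q => by
    rw [hW, dd_sub (cm _ hw) (cm _ sw'), dd_const_mul _ hw, dd_const_mul _ sw',
      dd_rsub_of_fst hw he]
  have rU : ∀ q, dd er U q = -3 * dd er u q + 8 * rsub 2 (-a) (dd er u) q := fun q => by
    rw [hU, dd_add (cm _ hu) (cm _ su'), dd_const_mul _ hu, dd_const_mul _ su',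
      dd_rsub_er hu]; ring
  have rW : ∀ q, dd er W q = 3 * dd er w q - 4 * rsub 2 (-a) (dd er w) q := fun q => by
    rw [hW, dd_sub (cm _ hw) (cm _ sw'), dd_const_mul _ hw, dd_const_mul _ sw',
      dd_rsub_er hw]; ring
  have rG : ∀ q, dd er G q = κ * (3 * dd er u q - 4 * rsub 2 (-a) (dd er u) q) := fun q => by
    rw [hG, dd_const_mul _ sG', dd_sub (cm _ hu) (cm _ su'), dd_const_mul _ hu,
      dd_const_mul _ su', dd_rsub_er hu]; ring
  -- the two traces agree
  have htr : sliceInt L (fun q => U q * (dd e W q + G q)) a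
      = sliceInt L (fun q => u q * (dd e w q + κ * u q)) a := by
    unfold sliceInt
    congr 1; funext p
    have e1 : ∀ f : ℝ × ℝ × ℝ → ℝ, rsub 2 (-a) f (a, p) = f (a, p) := fun f => by
      unfold rsub; congr 2; simp only; ring
    simp only [dW, hU, hG, hu', e1]
    ring
  set D := stripDensity h η κ e u w with hD
  have cD : Continuous D := continuous_stripDensity hu hw
  have cD' : Continuous (rsub 2 (-a) D) := by
    unfold rsub; exact cD.comp (by fun_prop)
  have nD : ∀ q, 0 ≤ D q := stripDensity_nonneg hη
  have cu := hu.cont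
  have cue := (hu.dd e).cont
  have cur := (hu.dd er).cont
  have cwe := (hw.dd e).cont
  have cwr := (hw.dd er).cont
  have ccut : Continuous (cutoff a h) := smooth_cutoff.cont
  have ccut2 : Continuous (cutoff a (h / 2)) := smooth_cutoff.cont
  have cU := sU.cont
  have cUe := (sU.dd e).cont
  have cUr := (sU.dd er).cont
  have cWe := (sW.dd e).cont
  have cWr := (sW.dd er).cont
  have cG := sG.cont
  have cGr := (sG.dd er).cont
  have ckr := (hku.dd er).cont
  have up : sliceInt L (fun q => u q * (dd e w q + κ * u q)) a ≤
      -(1 / 2) * boxInt L a (a + h) (fun q => cutoff a h q * dd er w q ^ 2)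
        + boxInt L a (a + h) D := by
    rw [← id1, ← boxInt_const_mul, ← boxInt_add (by fun_prop) cD]
    refine boxInt_mono (by fun_prop) (by fun_prop) fun q hq => ?_
    obtain ⟨c0, c1⟩ := cutoff_mem hh hq
    have := strip_pointwise_upper (t := dd e u q + dd er w q) (p := dd er u q)
      (Q := dd e w q + κ * u q) (v := u q) (W := dd er w q) c0 c1 hh hh1 hη hκ
    rw [add_sub_cancel_right] at this
    rw [dd_const_mul _ hu]
    exact this
  have low : -64 * (boxInt L a (a + h / 2) D + boxInt L a (a + h / 2) (rsub 2 (-a) D)) ≤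
      sliceInt L (fun q => U q * (dd e W q + G q)) a := by
    rw [← id2, ← boxInt_add cD cD', ← boxInt_const_mul]
    refine boxInt_mono (by fun_prop) (by fun_prop) fun q hq => ?_
    obtain ⟨c0, c1⟩ := cutoff_mem (half_pos hh) hq
    have := strip_pointwise_lower (t := dd e u q + dd er w q) (p := dd er u q)
      (Q := dd e w q + κ * u q) (v := u q)
      (t' := rsub 2 (-a) (dd e u) q + rsub 2 (-a) (dd er w) q)
      (p' := rsub 2 (-a) (dd er u) q) (Q' := rsub 2 (-a) (dd e w) q + κ * u' q)
      (v' := u' q) (W := dd er W q) c0 c1 hh hh1 hη hκ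
    rw [dU, dW, rU, rG]
    rw [rW] at this ⊢
    refine this.trans (le_of_eq ?_)
    simp only [hU, hG]
    rw [inv_div]
    ring
  have half1 := boxInt_half_le (L := L) (a := a) cD nD hh
  have half2 : boxInt L a (a + h / 2) (rsub 2 (-a) D) = 1 / 2 * boxInt L a (a + h) D := by
    rw [boxInt_rsub cD two_pos (by linarith)]
    congr 2 <;> ring
  rw [htr, half2] at low
  linarith

theorem strip_korn (hL : 0 ≤ L) (hh : 0 < h) (hh1 : h ≤ 1) (hη : 0 < η) (hκ : κ ^ 2 ≤ 1)
    (hA : Adm L e u w) (hu : Smooth u) (hw : Smooth w) :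
    boxInt L a (a + h) (fun q => dd er w q ^ 2) ≤
      388 * boxInt L a (a + h) (stripDensity h η κ e u w) := by
  have he := hA.fst_eq
  have h1 := strip_half (a := a) hL hh hh1 hη hκ hA hu hw
  set u' : ℝ × ℝ × ℝ → ℝ := fun q => -rsub (-1) (a + (a + h)) u q with hu'
  set w' := rsub (-1) (a + (a + h)) w with hw'
  have su := hu.rsub (-1) (a + (a + h))
  have su' : Smooth u' := ContDiff.neg su
  have sw' : Smooth w' := hw.rsub _ _
  have hA' : Adm L e u' w' := by
    rcases hA with ⟨rfl, pu, pw⟩ | ⟨rfl, hv⟩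
    · refine Or.inl ⟨rfl, fun q => ?_, pw.rsub _ _⟩
      simp only [hu']; rw [(pu.rsub _ _) q]
    · refine Or.inr ⟨rfl, hv.imp (fun hv r θ => ?_) (fun hv => hv.rsub _ _)⟩
      have := (hv.rsub (-1) (a + (a + h))) r θ
      simp [hu', this]
  have h2 := strip_half (a := a) (κ := -κ) hL hh hh1 hη (by simpa using hκ) hA' su' sw'
  have eD : stripDensity h η (-κ) e u' w' =
      rsub (-1) (a + (a + h)) (stripDensity h η κ e u w) := by
    funext q
    simp only [stripDensity, hu', dd_neg]
    rw [dd_rsub_of_fst hu he, dd_rsub_of_fst hw he, dd_rsub_er hu, dd_rsub_er hw]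
    simp only [rsub, stripDensity]
    ring
  have eC : (fun q => cutoff a h q * dd er w' q ^ 2) =
      rsub (-1) (a + (a + h)) (fun q => (1 - cutoff a h q) * dd er w q ^ 2) := by
    funext q
    rw [hw', dd_rsub_er hw]
    simp only [rsub, cutoff]
    field_simp
    ring
  have ccut : Continuous (cutoff a h) := smooth_cutoff.cont
  have cwr := (hw.dd er).cont
  rw [eD, eC, boxInt_reflect (continuous_stripDensity hu hw) (by linarith),
    boxInt_reflect (by fun_prop) (by linarith)] at h2
  have h3 : boxInt L a (a + h) (fun q => dd er w q ^ 2) =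
      boxInt L a (a + h) (fun q => cutoff a h q * dd er w q ^ 2) +
      boxInt L a (a + h) (fun q => (1 - cutoff a h q) * dd er w q ^ 2) := by
    rw [← boxInt_add (by fun_prop) (by fun_prop)]
    congr 1; funext q; ring
  linarith

end Strip

/-! ### Averages in the radial variable -/

section Parametric

/-- Differentiation under the integral sign over a compact set. -/
theorem hasFDerivAt_setIntegral_of_isCompact {H X E : Type*} [NormedAddCommGroup H]
    [NormedSpace ℝ H] [ProperSpace H] [TopologicalSpace X] [MeasurableSpace X]
    [OpensMeasurableSpace X] [T2Space X] {μ : Measure X} [IsFiniteMeasureOnCompacts μ]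
    [NormedAddCommGroup E] [NormedSpace ℝ E] [SecondCountableTopologyEither X E]
    [SecondCountableTopologyEither X (H →L[ℝ] E)]
    {K : Set X} (hK : IsCompact K) {F : H → X → E} {F' : H → X → H →L[ℝ] E}
    (hF : ∀ y, Continuous (F y)) (hF' : Continuous (Function.uncurry F'))
    (h : ∀ y x, HasFDerivAt (fun y => F y x) (F' y x) y) (y : H) :
    HasFDerivAt (fun y => ∫ x in K, F y x ∂μ) (∫ x in K, F' y x ∂μ) y := by
  obtain ⟨C, hC⟩ := ((isCompact_closedBall y (1 : ℝ)).prod hK).exists_bound_of_continuousOn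
    hF'.continuousOn
  have hfin : IsFiniteMeasure (μ.restrict K) := ⟨by simpa using hK.measure_lt_top⟩
  have hcont : Continuous (F' y) := hF'.comp (Continuous.prodMk_right y)
  refine hasFDerivAt_integral_of_dominated_of_fderiv_le (bound := fun _ => C)
    (Metric.closedBall_mem_nhds y one_pos) ?_ ?_ ?_ ?_ (integrable_const C) ?_
  · exact Filter.Eventually.of_forall fun y' =>
      (hF y').continuousOn.aestronglyMeasurable_of_isCompact hK hK.measurableSet
  · exact (hF y).continuousOn.integrableOn_compact hK
  · exact hcont.continuousOn.aestronglyMeasurable_of_isCompact hK hK.measurableSet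
  · filter_upwards [ae_restrict_mem hK.measurableSet] with x hx y' hy'
    exact hC (y', x) ⟨hy', hx⟩
  · exact ae_of_all _ fun x y' _ => h y' x

theorem contDiff_setIntegral_Icc {H E : Type} [NormedAddCommGroup H]
    [NormedSpace ℝ H] [ProperSpace H] [NormedAddCommGroup E] [NormedSpace ℝ E] (a b : ℝ) (n : ℕ)
    {f : H × ℝ → E} (hf : ContDiff ℝ (⊤ : ℕ∞) f) :
    ContDiff ℝ n (fun y => ∫ s in Set.Icc a b, f (y, s)) := by
  have key : ∀ {E : Type} [NormedAddCommGroup E] [NormedSpace ℝ E] {f : H × ℝ → E},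
      ContDiff ℝ (⊤ : ℕ∞) f → ∀ y, HasFDerivAt (fun y => ∫ s in Set.Icc a b, f (y, s))
        (∫ s in Set.Icc a b, (fderiv ℝ f (y, s)).comp (ContinuousLinearMap.inl ℝ H ℝ)) y := by
    intro E _ _ f hf y
    refine hasFDerivAt_setIntegral_of_isCompact isCompact_Icc
      (F' := fun y s => (fderiv ℝ f (y, s)).comp (ContinuousLinearMap.inl ℝ H ℝ))
      (fun y => hf.continuous.comp (Continuous.prodMk_right y)) ?_ ?_ y
    · exact (ContDiff.continuous_fderiv hf (by simp)).clm_comp continuous_const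
    · intro y s
      exact (hf.differentiable (by simp) (y, s)).hasFDerivAt.comp y (hasFDerivAt_prodMk_left y s)
  induction n generalizing E f with
  | zero =>
    exact contDiff_zero.2 (continuous_iff_continuousAt.2 fun y => (key hf y).continuousAt)
  | succ n ih =>
    exact contDiff_succ_iff_hasFDerivAt.2 ⟨_, ih ((ContDiff.fderiv_right (m := (⊤ : ℕ∞)) hf
      (by simp)).clm_comp contDiff_const), key hf⟩

end Parametric

section Average

variable {L a b h K : ℝ} {k k' : ℝ → ℝ} {e : ℝ × ℝ × ℝ} {f g : ℝ × ℝ × ℝ → ℝ}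

/-- The weighted radial integral of `f` over `[a,b]` with weight `k`. -/
def avg (a b : ℝ) (k : ℝ → ℝ) (f : ℝ × ℝ × ℝ → ℝ) (q : ℝ × ℝ × ℝ) : ℝ :=
  ∫ s in Set.Icc a b, k s * f (s, q.2)

theorem Smooth.avg (hk : ContDiff ℝ (⊤ : ℕ∞) k) (hf : Smooth f) : Smooth (avg a b k f) := by
  have h : ContDiff ℝ (⊤ : ℕ∞) (fun p : (ℝ × ℝ × ℝ) × ℝ => k p.2 * f (p.2, p.1.2)) :=
    (hk.comp contDiff_snd).mul (ContDiff.comp hf (by fun_prop))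
  exact contDiff_infty.2 fun n => contDiff_setIntegral_Icc a b n h

theorem fderiv_avg (hk : Continuous k) (hf : Smooth f) (q : ℝ × ℝ × ℝ) :
    dd e (avg a b k f) q = ∫ s in Set.Icc a b, k s * fderiv ℝ f (s, q.2) (0, e.2) := by
  set P : ℝ × ℝ × ℝ →L[ℝ] ℝ × ℝ × ℝ :=
    (0 : ℝ × ℝ × ℝ →L[ℝ] ℝ).prod (ContinuousLinearMap.snd ℝ ℝ (ℝ × ℝ)) with hP
  have hc : Continuous (fun p : (ℝ × ℝ × ℝ) × ℝ => k p.2 • (fderiv ℝ f (p.2, p.1.2)).comp P) := by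
    have h1 : Continuous (fderiv ℝ f) := ContDiff.continuous_fderiv hf (by simp)
    exact (hk.comp continuous_snd).smul
      ((h1.comp (by fun_prop : Continuous fun p : (ℝ × ℝ × ℝ) × ℝ => (p.2, p.1.2))).clm_comp
        continuous_const)
  have h := hasFDerivAt_setIntegral_of_isCompact (μ := volume) (isCompact_Icc (a := a) (b := b))
    (F := fun (q : ℝ × ℝ × ℝ) s => k s * f (s, q.2))
    (F' := fun (q : ℝ × ℝ × ℝ) s => k s • (fderiv ℝ f (s, q.2)).comp P)
    (fun y => hk.mul (hf.cont.comp (by fun_prop))) hc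
    (fun y s => ?_) q
  · have h2 : fderiv ℝ (avg a b k f) q = _ := h.fderiv
    unfold dd
    rw [h2, ContinuousLinearMap.integral_apply]
    · simp [hP]
    · exact (hc.comp (Continuous.prodMk_right q)).continuousOn.integrableOn_compact isCompact_Icc
  · have h3 : HasFDerivAt (fun q : ℝ × ℝ × ℝ => (s, q.2)) P y :=
      (hasFDerivAt_const s y).prodMk hasFDerivAt_snd
    exact ((hf.diff (s, y.2)).hasFDerivAt.comp y h3).const_mul (k s)

theorem dd_avg (hk : Continuous k) (hf : Smooth f) (he : e.1 = 0) :
    dd e (avg a b k f) = avg a b k (dd e f) := by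
  funext q
  rw [fderiv_avg hk hf, show ((0, e.2) : ℝ × ℝ × ℝ) = e by rw [← he]]
  rfl

theorem dd_er_avg (hk : Continuous k) (hf : Smooth f) (q : ℝ × ℝ × ℝ) :
    dd er (avg a b k f) q = 0 := by
  rw [fderiv_avg hk hf]
  have : ((0, er.2) : ℝ × ℝ × ℝ) = 0 := rfl
  simp [this]

theorem Periodic3.avg (hf : Periodic3 f) : Periodic3 (avg a b k f) := by
  intro q
  unfold _root_.avg
  congr 1; funext s
  rw [← hf (s, q.2)]

theorem VanZ.avg (hf : VanZ L f) : VanZ L (avg a b k f) := fun r θ => by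
  simp [_root_.avg, (hf _ θ).1, (hf _ θ).2]

theorem integrableOn_avg (hk : Continuous k) (hf : Continuous f) (p : ℝ × ℝ) :
    IntegrableOn (fun s => k s * f (s, p)) (Set.Icc a b) :=
  (Continuous.mul hk (hf.comp (Continuous.prodMk_left p))).continuousOn.integrableOn_compact
    isCompact_Icc

theorem avg_add (hk : Continuous k) (hf : Continuous f) (hg : Continuous g) (q : ℝ × ℝ × ℝ) :
    avg a b k (fun q => f q + g q) q = avg a b k f q + avg a b k g q := by
  unfold avg
  rw [← integral_add (integrableOn_avg hk hf _) (integrableOn_avg hk hg _)]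
  simp only [mul_add]

theorem avg_sub (hk : Continuous k) (hf : Continuous f) (hg : Continuous g) (q : ℝ × ℝ × ℝ) :
    avg a b k (fun q => f q - g q) q = avg a b k f q - avg a b k g q := by
  unfold avg
  rw [← integral_sub (integrableOn_avg hk hf _) (integrableOn_avg hk hg _)]
  simp only [mul_sub]

theorem avg_dd_er (hab : a ≤ b) (hk : ∀ s, HasDerivAt k (k' s) s) (hk' : Continuous k')
    (ha : k a = 0) (hb : k b = 0) (hf : Smooth f) (q : ℝ × ℝ × ℝ) :
    avg a b k (dd er f) q = -avg a b k' f q := by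
  have hkc : Continuous k := continuous_iff_continuousAt.2 fun s => (hk s).continuousAt
  unfold avg
  have hi : ∀ {k : ℝ → ℝ} {f : ℝ × ℝ × ℝ → ℝ}, Continuous k → Continuous f →
      IntervalIntegrable (fun s => k s * f (s, q.2)) volume a b := fun hk hf =>
    (Continuous.mul hk (hf.comp (Continuous.prodMk_left q.2))).intervalIntegrable _ _
  have h1 : ∀ s ∈ Set.uIcc a b, HasDerivAt (fun s => k s * f (s, q.2))
      (k' s * f (s, q.2) + k s * dd er f (s, q.2)) s := fun s _ =>
    (hk s).mul (hf.hasDerivAt_r s q.2.1 q.2.2)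
  have h2 := intervalIntegral.integral_eq_sub_of_hasDerivAt h1
    ((hi hk' hf.cont).add (hi hkc (hf.dd er).cont))
  rw [intervalIntegral.integral_add (hi hk' hf.cont) (hi hkc (hf.dd er).cont), ha, hb] at h2
  rw [setIntegral_Icc_eq hab, setIntegral_Icc_eq hab]
  linarith

theorem sq_setIntegral_Icc_le (hab : a < b) {F : ℝ → ℝ} (hF : Continuous F) :
    (∫ s in Set.Icc a b, F s) ^ 2 ≤ (b - a) * ∫ s in Set.Icc a b, F s ^ 2 := by
  have hi : ∀ {F : ℝ → ℝ}, Continuous F → IntegrableOn F (Set.Icc a b) := fun hF =>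
    hF.continuousOn.integrableOn_compact isCompact_Icc
  set I := ∫ s in Set.Icc a b, F s with hI
  set m := I / (b - a) with hm
  have h0 : 0 ≤ ∫ s in Set.Icc a b, (F s - m) ^ 2 :=
    integral_nonneg fun s => sq_nonneg _
  have h1 : ∫ s in Set.Icc a b, (F s - m) ^ 2
      = (∫ s in Set.Icc a b, F s ^ 2) - 2 * m * I + m ^ 2 * (b - a) := by
    have : (fun s => (F s - m) ^ 2) = fun s => (F s ^ 2 - 2 * m * F s) + m ^ 2 := by
      funext s; ring
    rw [this, integral_add (hi (by fun_prop)) (hi continuous_const),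
      integral_sub (hi (by fun_prop)) (hi (by fun_prop)), integral_const_mul]
    simp [hI, hab.le, mul_comm]
  have hba : 0 < b - a := sub_pos.2 hab
  have h2 : m * (b - a) = I := by rw [hm]; field_simp
  rw [h1] at h0
  nlinarith

theorem boxInt_mono_iter {F G : ℝ × ℝ × ℝ → ℝ} (hF : Continuous F) (hG : Continuous G)
    (h : ∀ p, ∫ r in Set.Icc a b, F (r, p) ≤ ∫ r in Set.Icc a b, G (r, p)) :
    boxInt L a b F ≤ boxInt L a b G := by
  rw [boxInt_iter_r hF, boxInt_iter_r hG]
  have hc : ∀ {F : ℝ × ℝ × ℝ → ℝ}, Continuous F → IntegrableOn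
      (fun p : ℝ × ℝ => ∫ r in Set.Icc a b, F (r, p)) (Set.Icc 0 (2 * π) ×ˢ Set.Icc 0 L) := by
    intro F hF
    refine ContinuousOn.integrableOn_compact (isCompact_Icc.prod isCompact_Icc) ?_
    exact (continuous_parametric_integral_of_continuous (f := fun (p : ℝ × ℝ) r => F (r, p))
      (hF.comp (continuous_snd.prodMk continuous_fst)) isCompact_Icc).continuousOn
  exact setIntegral_mono (hc hF) (hc hG) h

theorem sq_avg_le (hab : a < b) (hk : Continuous k) (hK : ∀ s ∈ Set.Icc a b, |k s| ≤ K)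
    (hf : Continuous f) (q : ℝ × ℝ × ℝ) :
    avg a b k f q ^ 2 ≤ K ^ 2 * (b - a) * ∫ s in Set.Icc a b, f (s, q.2) ^ 2 := by
  have hf' : Continuous fun s => f (s, q.2) := hf.comp (Continuous.prodMk_left q.2)
  refine (sq_setIntegral_Icc_le hab (F := fun s => k s * f (s, q.2)) (hk.mul hf')).trans ?_
  have : ∫ s in Set.Icc a b, (k s * f (s, q.2)) ^ 2 ≤
      ∫ s in Set.Icc a b, K ^ 2 * f (s, q.2) ^ 2 := by
    refine setIntegral_mono_on (Continuous.continuousOn (by fun_prop) |>.integrableOn_compact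
      isCompact_Icc) (Continuous.continuousOn (by fun_prop) |>.integrableOn_compact
      isCompact_Icc) measurableSet_Icc fun s hs => ?_
    rw [mul_pow]
    have h1 : k s ^ 2 ≤ K ^ 2 := by
      rw [← sq_abs]; exact pow_le_pow_left₀ (abs_nonneg _) (hK s hs) 2
    exact mul_le_mul_of_nonneg_right h1 (sq_nonneg _)
  rw [integral_const_mul] at this
  nlinarith [sub_pos.2 hab]

theorem boxInt_avg_sq_le (hab : a < b) (hk : ContDiff ℝ (⊤ : ℕ∞) k)
    (hK : ∀ s ∈ Set.Icc a b, |k s| ≤ K) (hf : Smooth f) :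
    boxInt L a b (fun q => avg a b k f q ^ 2) ≤
      (K * (b - a)) ^ 2 * boxInt L a b (fun q => f q ^ 2) := by
  have c1 := (hf.avg (a := a) (b := b) hk).cont
  have c2 := hf.cont
  rw [← boxInt_const_mul]
  refine boxInt_mono_iter (by fun_prop) (by fun_prop) fun p => ?_
  have h1 := sq_avg_le hab hk.continuous hK hf.cont (a, p)
  have h2 : ∀ r, avg a b k f (r, p) = avg a b k f (a, p) := fun r => rfl
  simp only [h2]
  rw [integral_const_mul, setIntegral_const]
  simp only [volume_real_Icc_of_le hab.le, smul_eq_mul]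
  calc (b - a) * avg a b k f (a, p) ^ 2
      ≤ (b - a) * (K ^ 2 * (b - a) * ∫ s in Set.Icc a b, f (s, p) ^ 2) :=
        mul_le_mul_of_nonneg_left h1 (sub_pos.2 hab).le
    _ = _ := by ring

theorem boxInt_sub_avg_sq_le (hab : a < b) (hk : ContDiff ℝ (⊤ : ℕ∞) k)
    (hK : ∀ s ∈ Set.Icc a b, |k s| ≤ K) (hk1 : ∫ s in Set.Icc a b, k s = 1) (hf : Smooth f) :
    boxInt L a b (fun q => (f q - avg a b k f q) ^ 2) ≤
      (K * (b - a)) ^ 2 * (b - a) ^ 2 * boxInt L a b (fun q => dd er f q ^ 2) := by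
  have c1 := (hf.avg (a := a) (b := b) hk).cont
  have c2 := hf.cont
  have c3 := (hf.dd er).cont
  have hba : 0 < b - a := sub_pos.2 hab
  rw [← boxInt_const_mul]
  refine boxInt_mono_iter (by fun_prop) (by fun_prop) fun p => ?_
  have cf : Continuous fun s => f (s, p) := c2.comp (Continuous.prodMk_left p)
  have cd : Continuous fun s => dd er f (s, p) := c3.comp (Continuous.prodMk_left p)
  have hkc := hk.continuous
  set I := ∫ s in Set.Icc a b, dd er f (s, p) ^ 2 with hI
  set B := ∫ s in Set.Icc a b, |dd er f (s, p)| with hB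
  have hBI : B ^ 2 ≤ (b - a) * I := by
    simpa only [sq_abs] using sq_setIntegral_Icc_le hab cd.abs
  have osc : ∀ r ∈ Set.Icc a b, ∀ s ∈ Set.Icc a b, |f (r, p) - f (s, p)| ≤ B := by
    intro r hr s hs
    rw [← intervalIntegral.integral_eq_sub_of_hasDerivAt
      (fun t _ => hf.hasDerivAt_r t p.1 p.2) (cd.intervalIntegrable s r)]
    rw [← Real.norm_eq_abs]
    refine (intervalIntegral.norm_integral_le_integral_norm_uIoc).trans ?_
    simp only [Real.norm_eq_abs]
    refine setIntegral_mono_set (cd.abs.continuousOn.integrableOn_compact isCompact_Icc)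
      (ae_of_all _ fun _ => abs_nonneg _) (LE.le.eventuallyLE ?_)
    exact Set.uIoc_subset_uIcc.trans (Set.uIcc_subset_Icc hs hr)
  have pt : ∀ r ∈ Set.Icc a b, (f (r, p) - avg a b k f (r, p)) ^ 2 ≤
      (K * (b - a)) ^ 2 * ((b - a) * I) := by
    intro r hr
    have e1 : f (r, p) - avg a b k f (r, p) = ∫ s in Set.Icc a b, k s * (f (r, p) - f (s, p)) := by
      have : (fun s => k s * (f (r, p) - f (s, p))) = fun s => k s * f (r, p) - k s * f (s, p) := by
        funext s; ring
      rw [this, integral_sub (Continuous.continuousOn (by fun_prop) |>.integrableOn_compact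
        isCompact_Icc) (Continuous.continuousOn (by fun_prop) |>.integrableOn_compact
        isCompact_Icc), integral_mul_const, hk1, one_mul]
      rfl
    have hB0 : 0 ≤ B := integral_nonneg fun _ => abs_nonneg _
    have e2 : |f (r, p) - avg a b k f (r, p)| ≤ K * B * (b - a) := by
      rw [e1, ← Real.norm_eq_abs]
      refine (norm_setIntegral_le_of_norm_le_const (C := K * B) isCompact_Icc.measure_lt_top
        fun s hs => ?_).trans (le_of_eq ?_)
      · rw [Real.norm_eq_abs, abs_mul]
        exact mul_le_mul (hK s hs) (osc r hr s hs) (abs_nonneg _)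
          ((abs_nonneg _).trans (hK s hs))
      · rw [volume_real_Icc_of_le hab.le]
    rw [← sq_abs]
    calc |f (r, p) - avg a b k f (r, p)| ^ 2 ≤ (K * B * (b - a)) ^ 2 :=
          pow_le_pow_left₀ (abs_nonneg _) e2 2
      _ = (K * (b - a)) ^ 2 * B ^ 2 := by ring
      _ ≤ _ := mul_le_mul_of_nonneg_left hBI (sq_nonneg _)
  calc ∫ r in Set.Icc a b, (f (r, p) - avg a b k f (r, p)) ^ 2
      ≤ ∫ r in Set.Icc a b, (K * (b - a)) ^ 2 * ((b - a) * I) := by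
        refine setIntegral_mono_on ?_ ?_ measurableSet_Icc pt
        · exact (((c2.sub c1).pow 2).comp (Continuous.prodMk_left p)).continuousOn.integrableOn_compact
            isCompact_Icc
        · exact continuousOn_const.integrableOn_compact isCompact_Icc
    _ = ∫ r in Set.Icc a b, (K * (b - a)) ^ 2 * (b - a) ^ 2 * dd er f (r, p) ^ 2 := by
        rw [integral_const_mul, setIntegral_const, volume_real_Icc_of_le hab.le, hI, integral_const_mul]
        simp only [smul_eq_mul]; ring

/-- The parabolic kernel on `[a,a+h]`. -/
def ker (a h s : ℝ) : ℝ := 6 * (s - a) * (a + h - s) / h ^ 3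

/-- The average with respect to the parabolic kernel. -/
def av (a h : ℝ) (f : ℝ × ℝ × ℝ → ℝ) : ℝ × ℝ × ℝ → ℝ := avg a (a + h) (ker a h) f

theorem contDiff_ker : ContDiff ℝ (⊤ : ℕ∞) (ker a h) := by unfold ker; fun_prop

theorem abs_ker_le (hh : 0 < h) : ∀ s ∈ Set.Icc a (a + h), |ker a h s| ≤ 3 / (2 * h) := by
  rintro s ⟨h1, h2⟩
  have h3 : 0 ≤ ker a h s := by
    unfold ker
    have := mul_nonneg (sub_nonneg.2 h1) (sub_nonneg.2 h2)
    rw [mul_assoc]; positivity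
  rw [abs_of_nonneg h3]
  unfold ker
  rw [div_le_div_iff₀ (by positivity) (by positivity)]
  have : 4 * ((s - a) * (a + h - s)) ≤ h ^ 2 := by nlinarith [sq_nonneg (2 * s - 2 * a - h)]
  nlinarith [mul_le_mul_of_nonneg_right this hh.le]

theorem integral_ker (hh : 0 < h) : ∫ s in Set.Icc a (a + h), ker a h s = 1 := by
  rw [setIntegral_Icc_eq (by linarith)]
  have hd : ∀ s ∈ Set.uIcc a (a + h),
      HasDerivAt (fun s => (3 * h * (s - a) ^ 2 - 2 * (s - a) ^ 3) / h ^ 3) (ker a h s) s := by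
    intro s _
    have h1 : HasDerivAt (fun s => s - a) 1 s := (hasDerivAt_id s).sub_const a
    refine ((((h1.pow 2).const_mul (3 * h)).sub ((h1.pow 3).const_mul 2)).div_const
      (h ^ 3)).congr_deriv ?_
    unfold ker; push_cast; ring
  rw [intervalIntegral.integral_eq_sub_of_hasDerivAt hd
    (contDiff_ker.continuous.intervalIntegrable _ _)]
  field_simp; ring

theorem hasDerivAt_ker (s : ℝ) : HasDerivAt (ker a h) (6 * (2 * a + h - 2 * s) / h ^ 3) s := by
  have h1 : HasDerivAt (fun s => s - a) 1 s := (hasDerivAt_id s).sub_const a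
  have h2 : HasDerivAt (fun s => a + h - s) (-1) s := (hasDerivAt_id s).const_sub (a + h)
  refine (((h1.const_mul 6).mul h2).div_const (h ^ 3)).congr_deriv ?_
  ring

theorem Smooth.av (hf : Smooth f) : Smooth (av a h f) := hf.avg contDiff_ker

theorem dd_av (hf : Smooth f) (he : e.1 = 0) : dd e (av a h f) = av a h (dd e f) :=
  dd_avg contDiff_ker.continuous hf he

theorem dd_er_av (hf : Smooth f) (q : ℝ × ℝ × ℝ) : dd er (av a h f) q = 0 :=
  dd_er_avg contDiff_ker.continuous hf q

theorem Periodic3.av (hf : Periodic3 f) : Periodic3 (av a h f) := hf.avg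

theorem VanZ.av (hf : VanZ L f) : VanZ L (av a h f) := hf.avg

theorem av_add (hf : Smooth f) (hg : Smooth g) (q : ℝ × ℝ × ℝ) :
    av a h (fun q => f q + g q) q = av a h f q + av a h g q :=
  avg_add contDiff_ker.continuous hf.cont hg.cont q

theorem av_sub (hf : Smooth f) (hg : Smooth g) (q : ℝ × ℝ × ℝ) :
    av a h (fun q => f q - g q) q = av a h f q - av a h g q :=
  avg_sub contDiff_ker.continuous hf.cont hg.cont q

theorem boxInt_av_sq_le (hh : 0 < h) (hf : Smooth f) :
    boxInt L a (a + h) (fun q => av a h f q ^ 2) ≤ 9 / 4 * boxInt L a (a + h) (fun q => f q ^ 2) := by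
  have := boxInt_avg_sq_le (L := L) (by linarith : a < a + h) contDiff_ker (abs_ker_le hh) hf
  refine this.trans (le_of_eq ?_)
  congr 1
  field_simp; ring

theorem boxInt_av_dr_sq_le (hh : 0 < h) (hf : Smooth f) :
    boxInt L a (a + h) (fun q => av a h (dd er f) q ^ 2) ≤
      36 / h ^ 2 * boxInt L a (a + h) (fun q => f q ^ 2) := by
  have hk' : ContDiff ℝ (⊤ : ℕ∞) fun s => 6 * (2 * a + h - 2 * s) / h ^ 3 := by fun_prop
  have h1 : ∀ q, av a h (dd er f) q = -avg a (a + h) (fun s => 6 * (2 * a + h - 2 * s) / h ^ 3) f q :=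
    avg_dd_er (by linarith) hasDerivAt_ker hk'.continuous (by simp [ker]) (by simp [ker]) hf
  simp only [h1, neg_sq]
  have := boxInt_avg_sq_le (L := L) (K := 6 / h ^ 2) (by linarith : a < a + h) hk' ?_ hf
  · convert this using 2
    field_simp; ring
  · rintro s ⟨h2, h3⟩
    rw [abs_le, neg_le, ← neg_div, div_le_div_iff₀ (by positivity) (by positivity),
      div_le_div_iff₀ (by positivity) (by positivity)]
    have : 0 < h ^ 2 := by positivity
    constructor <;> nlinarith

theorem boxInt_sub_av_sq_le (hh : 0 < h) (hf : Smooth f) :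
    boxInt L a (a + h) (fun q => (f q - av a h f q) ^ 2) ≤
      9 / 4 * h ^ 2 * boxInt L a (a + h) (fun q => dd er f q ^ 2) := by
  have := boxInt_sub_avg_sq_le (L := L) (by linarith : a < a + h) contDiff_ker (abs_ker_le hh)
    (integral_ker hh) hf
  refine this.trans (le_of_eq ?_)
  congr 1
  field_simp; ring

end Average

/-! ### Bilinear identities and inequalities on a box -/

/-- The squared `L²` norm on a box. -/
def nsq (L a b : ℝ) (f : ℝ × ℝ × ℝ → ℝ) : ℝ := boxInt L a b (fun q => f q ^ 2)

/-- The `L²` inner product on a box. -/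
def ip (L a b : ℝ) (f g : ℝ × ℝ × ℝ → ℝ) : ℝ := boxInt L a b (fun q => f q * g q)

section InnerProduct

variable {L a b : ℝ} {f g f₁ f₂ f₃ g₁ g₂ g₃ : ℝ × ℝ × ℝ → ℝ} {e : ℝ × ℝ × ℝ}

theorem nsq_nonneg : 0 ≤ nsq L a b f := boxInt_nonneg fun _ _ => sq_nonneg _

theorem ip_self : ip L a b f f = nsq L a b f := by
  unfold ip nsq; congr 1; funext q; ring

theorem ip_comm : ip L a b f g = ip L a b g f := by
  unfold ip; congr 1; funext q; ring

theorem ip_add_right (hf : Continuous f) (h₁ : Continuous g₁) (h₂ : Continuous g₂) :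
    ip L a b f (fun q => g₁ q + g₂ q) = ip L a b f g₁ + ip L a b f g₂ := by
  unfold ip
  rw [← boxInt_add (by fun_prop) (by fun_prop)]
  simp only [mul_add]

theorem ip_sub_right (hf : Continuous f) (h₁ : Continuous g₁) (h₂ : Continuous g₂) :
    ip L a b f (fun q => g₁ q - g₂ q) = ip L a b f g₁ - ip L a b f g₂ := by
  unfold ip
  rw [← boxInt_sub (by fun_prop) (by fun_prop)]
  simp only [mul_sub]

theorem ip_sub_left (hf : Continuous f) (h₁ : Continuous g₁) (h₂ : Continuous g₂) :
    ip L a b (fun q => g₁ q - g₂ q) f = ip L a b g₁ f - ip L a b g₂ f := by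
  rw [ip_comm, ip_sub_right hf h₁ h₂, ip_comm, ip_comm (f := f)]

theorem nsq_le₁ {c₁ : ℝ} (hf : Continuous f) (h₁ : Continuous g₁)
    (h : ∀ q ∈ box L a b, f q ^ 2 ≤ c₁ * g₁ q ^ 2) : nsq L a b f ≤ c₁ * nsq L a b g₁ := by
  unfold nsq
  rw [← boxInt_const_mul]
  exact boxInt_mono (by fun_prop) (by fun_prop) h

theorem nsq_le₂ {c₁ c₂ : ℝ} (hf : Continuous f) (h₁ : Continuous g₁) (h₂ : Continuous g₂)
    (h : ∀ q ∈ box L a b, f q ^ 2 ≤ c₁ * g₁ q ^ 2 + c₂ * g₂ q ^ 2) :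
    nsq L a b f ≤ c₁ * nsq L a b g₁ + c₂ * nsq L a b g₂ := by
  unfold nsq
  rw [← boxInt_const_mul, ← boxInt_const_mul, ← boxInt_add (by fun_prop) (by fun_prop)]
  exact boxInt_mono (by fun_prop) (by fun_prop) h

theorem nsq_le₃ {c₁ c₂ c₃ : ℝ} (hf : Continuous f) (h₁ : Continuous g₁) (h₂ : Continuous g₂)
    (h₃ : Continuous g₃)
    (h : ∀ q ∈ box L a b, f q ^ 2 ≤ c₁ * g₁ q ^ 2 + c₂ * g₂ q ^ 2 + c₃ * g₃ q ^ 2) :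
    nsq L a b f ≤ c₁ * nsq L a b g₁ + c₂ * nsq L a b g₂ + c₃ * nsq L a b g₃ := by
  unfold nsq
  rw [← boxInt_const_mul, ← boxInt_const_mul, ← boxInt_const_mul,
    ← boxInt_add (by fun_prop) (by fun_prop), ← boxInt_add (by fun_prop) (by fun_prop)]
  exact boxInt_mono (by fun_prop) (by fun_prop) h

theorem nsq_add_le (h₁ : Continuous g₁) (h₂ : Continuous g₂) :
    nsq L a b (fun q => g₁ q + g₂ q) ≤ 2 * nsq L a b g₁ + 2 * nsq L a b g₂ :=
  nsq_le₂ (by fun_prop) h₁ h₂ fun q _ => by nlinarith [sq_nonneg (g₁ q - g₂ q)]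

theorem nsq_sub_le (h₁ : Continuous g₁) (h₂ : Continuous g₂) :
    nsq L a b (fun q => g₁ q - g₂ q) ≤ 2 * nsq L a b g₁ + 2 * nsq L a b g₂ :=
  nsq_le₂ (by fun_prop) h₁ h₂ fun q _ => by nlinarith [sq_nonneg (g₁ q + g₂ q)]

/-- Young's inequality with a weight. -/
theorem abs_ip_le {η : ℝ} (hη : 0 < η) (hf : Continuous f) (hg : Continuous g) :
    |ip L a b f g| ≤ η / 2 * nsq L a b f + 1 / (2 * η) * nsq L a b g := by
  have key : ∀ x y : ℝ, |x * y| ≤ η / 2 * x ^ 2 + 1 / (2 * η) * y ^ 2 := by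
    intro x y
    have h1 : 0 ≤ η * (x - y / η) ^ 2 := by positivity
    have h2 : 0 ≤ η * (x + y / η) ^ 2 := by positivity
    have e1 : η * (x - y / η) ^ 2 = η * x ^ 2 - 2 * (x * y) + 1 / η * y ^ 2 := by
      field_simp; ring
    have e2 : η * (x + y / η) ^ 2 = η * x ^ 2 + 2 * (x * y) + 1 / η * y ^ 2 := by
      field_simp; ring
    have e3 : 1 / (2 * η) * y ^ 2 = 1 / 2 * (1 / η * y ^ 2) := by field_simp
    rw [abs_le, e3]
    constructor <;> linarith
  have h1 : ip L a b f g ≤ η / 2 * nsq L a b f + 1 / (2 * η) * nsq L a b g := by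
    unfold ip nsq
    rw [← boxInt_const_mul, ← boxInt_const_mul, ← boxInt_add (by fun_prop) (by fun_prop)]
    exact boxInt_mono (by fun_prop) (by fun_prop) fun q _ => (le_abs_self _).trans (key _ _)
  have h2 : -ip L a b f g ≤ η / 2 * nsq L a b f + 1 / (2 * η) * nsq L a b g := by
    unfold ip nsq
    rw [← boxInt_const_mul, ← boxInt_const_mul, ← boxInt_add (by fun_prop) (by fun_prop),
      ← boxInt_neg]
    exact boxInt_mono (by fun_prop) (by fun_prop) fun q _ => (neg_le_abs _).trans (key _ _)
  exact abs_le'.2 ⟨h1, h2⟩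

theorem abs_ip_le_of {η A B : ℝ} (hη : 0 < η) (hf : Continuous f) (hg : Continuous g)
    (hA : nsq L a b f ≤ A) (hB : nsq L a b g ≤ B) :
    |ip L a b f g| ≤ η / 2 * A + 1 / (2 * η) * B :=
  (abs_ip_le hη hf hg).trans (add_le_add (mul_le_mul_of_nonneg_left hA (by positivity))
    (mul_le_mul_of_nonneg_left hB (by positivity)))

theorem ip_dd_z (hL : 0 ≤ L) (hf : Smooth f) (hg : Smooth g) (hv : VanZ L f ∨ VanZ L g) :
    ip L a b (dd ez f) g = -ip L a b f (dd ez g) := by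
  have h1 := boxInt_dz (L := L) (a := a) (b := b) (f := fun q => f q * g q) (ContDiff.mul hf hg)
    (hv.elim (fun h => h.mul_left g) (fun h => h.mul_right f)) hL
  have h2 : dd ez (fun q => f q * g q) = fun q => dd ez f q * g q + f q * dd ez g q :=
    funext (dd_mul hf hg)
  have c1 := hf.cont
  have c2 := hg.cont
  have c3 := (hf.dd ez).cont
  have c4 := (hg.dd ez).cont
  rw [h2, boxInt_add (by fun_prop) (by fun_prop)] at h1
  unfold ip
  linarith

theorem ip_dd_t (hf : Smooth f) (hg : Smooth g) (pf : Periodic3 f) (pg : Periodic3 g) :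
    ip L a b (dd et f) g = -ip L a b f (dd et g) := by
  have h1 := boxInt_dt (L := L) (a := a) (b := b) (f := fun q => f q * g q) (ContDiff.mul hf hg)
    (fun q => by simp only [pf q, pg q])
  have h2 : dd et (fun q => f q * g q) = fun q => dd et f q * g q + f q * dd et g q :=
    funext (dd_mul hf hg)
  have c1 := hf.cont
  have c2 := hg.cont
  have c3 := (hf.dd et).cont
  have c4 := (hg.dd et).cont
  rw [h2, boxInt_add (by fun_prop) (by fun_prop)] at h1
  unfold ip
  linarith

/-- Exchange of the `θ` and `z` derivatives in an inner product. -/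
theorem ip_cross (hL : 0 ≤ L) (hf : Smooth f) (hg : Smooth g) (pf : Periodic3 f)
    (pg : Periodic3 g) (hv : VanZ L f ∨ VanZ L g) :
    ip L a b (dd ez f) (dd et g) = ip L a b (dd et f) (dd ez g) := by
  rw [ip_dd_z hL hf (hg.dd et) (hv.imp_right fun h => h.dd hg rfl),
    ip_dd_t hf (hg.dd ez) pf (pg.dd ez), dd_comm hg]

theorem poincare (hL : 0 ≤ L) (hf : Smooth f) (hv : VanZ L f) :
    nsq L a b f ≤ 4 * L ^ 2 * nsq L a b (dd ez f) := by
  have hz : Smooth fun q : ℝ × ℝ × ℝ => q.2.2 := by unfold Smooth; fun_prop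
  have hf2 : Smooth fun q => f q * f q := ContDiff.mul hf hf
  have h1 := boxInt_dz (L := L) (a := a) (b := b) (f := fun q => q.2.2 * (f q * f q))
    (ContDiff.mul hz hf2) ((hv.mul_left f).mul_right _) hL
  have hzz : ∀ q, dd ez (fun q : ℝ × ℝ × ℝ => q.2.2) q = 1 := by
    intro q
    have : HasFDerivAt (fun q : ℝ × ℝ × ℝ => q.2.2)
      ((ContinuousLinearMap.snd ℝ ℝ ℝ).comp (ContinuousLinearMap.snd ℝ ℝ (ℝ × ℝ))) q :=
      hasFDerivAt_snd.comp q hasFDerivAt_snd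
    simp [dd, this.fderiv]
  have h2 : ∀ q, dd ez (fun q => q.2.2 * (f q * f q)) q
      = f q ^ 2 + 2 * q.2.2 * f q * dd ez f q := fun q => by
    rw [dd_mul hz hf2, dd_mul hf hf, hzz]; ring
  have cf := hf.cont
  have cd := (hf.dd ez).cont
  have h3 : boxInt L a b (fun q => 1 / 2 * f q ^ 2 - 2 * L ^ 2 * dd ez f q ^ 2) ≤
      boxInt L a b (dd ez (fun q => q.2.2 * (f q * f q))) := by
    refine boxInt_mono (by fun_prop) (Smooth.dd (ContDiff.mul hz hf2) ez).cont fun q hq => ?_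
    rw [h2]
    have hz0 : 0 ≤ q.2.2 := hq.2.2.1
    have hzL : q.2.2 ≤ L := hq.2.2.2
    have : q.2.2 ^ 2 ≤ L ^ 2 := pow_le_pow_left₀ hz0 hzL 2
    nlinarith [sq_nonneg (f q + 2 * q.2.2 * dd ez f q),
      mul_le_mul_of_nonneg_right this (sq_nonneg (dd ez f q))]
  rw [h1, boxInt_sub (by fun_prop) (by fun_prop), boxInt_const_mul, boxInt_const_mul] at h3
  unfold nsq
  linarith

theorem nsq_shift (hf : Continuous f) (pf : Periodic3 f) (t : ℝ) :
    nsq L a b (shift t f) = nsq L a b f :=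
  boxInt_shift (f := fun q => f q ^ 2) (hf.pow 2) (fun q => by simp only [pf q]) t

theorem hasDerivAt_ip_shift (hf : Continuous f) (hg : Smooth g) (t : ℝ) :
    HasDerivAt (fun t => ip L a b f (shift t g)) (ip L a b f (shift t (dd et g))) t := by
  have cs : ∀ {g : ℝ × ℝ × ℝ → ℝ}, Continuous g →
      Continuous (fun p : ℝ × (ℝ × ℝ × ℝ) => f p.2 * shift p.1 g p.2) := fun hg =>
    (hf.comp continuous_snd).mul (hg.comp (by fun_prop))
  have h := hasFDerivAt_setIntegral_of_isCompact (μ := volume) (isCompact_box L a b)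
    (F := fun t q => f q * shift t g q)
    (F' := fun t q => (f q * shift t (dd et g) q) • (1 : ℝ →L[ℝ] ℝ))
    (fun t => (cs hg.cont).comp (Continuous.prodMk_right t))
    ((cs (hg.dd et).cont).smul continuous_const)
    (fun t q => ?_) t
  · refine h.hasDerivAt.congr_deriv ?_
    rw [integral_smul_const]
    simp [ip, boxInt]
  · have h1 : HasDerivAt (fun t => shift t g q) (shift t (dd et g) q) t :=
      (hg.hasDerivAt_t q.1 (q.2.1 + t) q.2.2).comp_const_add q.2.1 t
    refine (h1.const_mul (f q)).hasFDerivAt.congr_fderiv ?_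
    ext; simp

end InnerProduct

/-! ### Estimates for shell fields -/

theorem smooth_fst_mul {f : ℝ × ℝ × ℝ → ℝ} (hf : Smooth f) : Smooth (fun q => q.1 * f q) :=
  ContDiff.mul contDiff_fst hf

theorem dd_fst_mul {f : ℝ × ℝ × ℝ → ℝ} {e : ℝ × ℝ × ℝ} (hf : Smooth f) (he : e.1 = 0) :
    dd e (fun q => q.1 * f q) = fun q => q.1 * dd e f q := by
  funext q
  have h1 : Smooth (fun q : ℝ × ℝ × ℝ => q.1) := contDiff_fst
  have h2 : dd e (fun q : ℝ × ℝ × ℝ => q.1) q = 0 := by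
    have := dd_fst_affine (e := e) 1 0 q
    simpa [he] using this
  rw [dd_mul h1 hf, h2, zero_mul, zero_add]

/-- Smooth periodic fields with the common consequences of the two sets of boundary conditions,
whose symmetrized gradient is controlled by `E` in the squared `L²` norm. -/
structure IsShellField (L h E : ℝ) (u v w : ℝ × ℝ × ℝ → ℝ) : Prop where
  hL : 0 < L
  hh : 0 < h
  hh1 : h ≤ 1 / 25
  hu : Smooth u
  hv : Smooth v
  hw : Smooth w
  pu : Periodic3 u
  pv : Periodic3 v
  pw : Periodic3 w
  bv : VanZ L v
  buw : VanZ L u ∨ VanZ L w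
  le_rr : nsq L (1 - h / 2) (1 - h / 2 + h) (dd er u) ≤ E
  le_tt : nsq L (1 - h / 2) (1 - h / 2 + h) (fun q => dd et v q + u q) ≤ 9 / 4 * E
  le_zz : nsq L (1 - h / 2) (1 - h / 2 + h) (dd ez w) ≤ E
  le_rz : nsq L (1 - h / 2) (1 - h / 2 + h) (fun q => dd ez u q + dd er w q) ≤ 2 * E
  le_rt : nsq L (1 - h / 2) (1 - h / 2 + h)
    (fun q => q.1 * dd er v q + (dd et u q - v q)) ≤ 9 / 2 * E
  le_tz : nsq L (1 - h / 2) (1 - h / 2 + h) (fun q => q.1 * dd ez v q + dd et w q) ≤ 9 / 2 * E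

namespace IsShellField

variable {L h E : ℝ} {u v w : ℝ × ℝ × ℝ → ℝ}

theorem mem_box (H : IsShellField L h E u v w) {q : ℝ × ℝ × ℝ}
    (hq : q ∈ box L (1 - h / 2) (1 - h / 2 + h)) :
    49 / 50 ≤ q.1 ∧ q.1 ≤ 51 / 50 ∧ (q.1 - 1) ^ 2 ≤ h ^ 2 / 4 := by
  have h1 := hq.1.1
  have h2 := hq.1.2
  have := H.hh1
  have := H.hh
  exact ⟨by linarith, by linarith, by nlinarith⟩

theorem energy_nonneg (H : IsShellField L h E u v w) : 0 ≤ E := nsq_nonneg.trans H.le_rr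

theorem nsq_fst_mul_le (H : IsShellField L h E u v w) {f : ℝ × ℝ × ℝ → ℝ} (hf : Continuous f) :
    nsq L (1 - h / 2) (1 - h / 2 + h) (fun q => q.1 * f q) ≤
      9 / 4 * nsq L (1 - h / 2) (1 - h / 2 + h) f :=
  nsq_le₁ (by fun_prop) hf fun q hq => by
    obtain ⟨h1, h2, -⟩ := H.mem_box hq
    rw [mul_pow]
    exact mul_le_mul_of_nonneg_right (by nlinarith) (sq_nonneg _)

theorem nsq_dz_v_le (H : IsShellField L h E u v w) {δ : ℝ} (hδ : 0 < δ) :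
    1 / 4 * nsq L (1 - h / 2) (1 - h / 2 + h) (dd ez v) +
        nsq L (1 - h / 2) (1 - h / 2 + h) (dd et w) ≤
      9 * E + δ * nsq L (1 - h / 2) (1 - h / 2 + h) u + 9 / 4 * E / δ := by
  set a := 1 - h / 2
  set b := a + h
  have H' := H
  obtain ⟨hL, hh, -, hu, hv, hw, pu, pv, pw, bv, -, -, le_tt, le_zz, -, -, le_tz⟩ := H'
  have srw := smooth_fst_mul hw
  have hx := ip_cross (L := L) (a := a) (b := b) hL.le hv srw pv
    (fun q => by simp only [pw q]) (Or.inl bv)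
  rw [dd_fst_mul hw rfl, dd_fst_mul hw rfl] at hx
  have cu := hu.cont
  have cvt := (hv.dd et).cont
  have cvz := (hv.dd ez).cont
  have cwt := (hw.dd et).cont
  have cwz := (hw.dd ez).cont
  have hrw : nsq L a b (fun q => q.1 * dd ez w q) ≤ 9 / 4 * E :=
    (H.nsq_fst_mul_le cwz).trans (by linarith)
  have e1 : ip L a b (dd et v) (fun q => q.1 * dd ez w q) =
      ip L a b (fun q => dd et v q + u q) (fun q => q.1 * dd ez w q) -
        ip L a b u (fun q => q.1 * dd ez w q) := by
    rw [← ip_sub_left (by fun_prop) (by fun_prop) (by fun_prop)]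
    congr 1; funext q; ring
  have e2 := abs_ip_le_of one_pos (by fun_prop) (by fun_prop) le_tt hrw
  have e3 := abs_ip_le_of hδ cu (by fun_prop) (le_refl (nsq L a b u)) hrw
  have e4 : 1 / 4 * nsq L a b (dd ez v) + nsq L a b (dd et w) ≤
      nsq L a b (fun q => q.1 * dd ez v q + dd et w q) -
        2 * ip L a b (dd ez v) (fun q => q.1 * dd et w q) := by
    unfold nsq ip
    rw [← boxInt_const_mul, ← boxInt_const_mul, ← boxInt_add (by fun_prop) (by fun_prop),
      ← boxInt_sub (by fun_prop) (by fun_prop)]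
    refine boxInt_mono (by fun_prop) (by fun_prop) fun q hq => ?_
    obtain ⟨h1, -, -⟩ := H.mem_box hq
    have h2 : 1 / 4 ≤ q.1 ^ 2 := by nlinarith
    nlinarith [mul_le_mul_of_nonneg_right h2 (sq_nonneg (dd ez v q))]
  rw [hx, e1] at e4
  rw [abs_le] at e2 e3
  have e5 : 1 / (2 * δ) * (9 / 4 * E) = 1 / 2 * (9 / 4 * E / δ) := by field_simp
  rw [e5] at e3
  norm_num at e2
  linarith [e2.1, e3.2]

theorem nsq_shear_le (H : IsShellField L h E u v w) :
    nsq L (1 - h / 2) (1 - h / 2 + h) (fun q => dd et u q + dd er v q) ≤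
      3 * (9 / 2 * E + h ^ 2 / 4 * nsq L (1 - h / 2) (1 - h / 2 + h) (dd er v) +
        nsq L (1 - h / 2) (1 - h / 2 + h) v) := by
  have cut := (H.hu.dd et).cont
  have cvr := (H.hv.dd er).cont
  have cv := H.hv.cont
  have h1 := nsq_le₃ (L := L) (a := 1 - h / 2) (b := 1 - h / 2 + h)
    (f := fun q => dd et u q + dd er v q)
    (g₁ := fun q => q.1 * dd er v q + (dd et u q - v q)) (g₂ := dd er v) (g₃ := v)
    (c₁ := 3) (c₂ := 3 * (h ^ 2 / 4)) (c₃ := 3)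
    (by fun_prop) (by fun_prop) (by fun_prop) (by fun_prop) ?_
  · linarith [H.le_rt]
  · intro q hq
    obtain ⟨-, -, h2⟩ := H.mem_box hq
    have key : ∀ x y z : ℝ, (x - y + z) ^ 2 ≤ 3 * x ^ 2 + 3 * y ^ 2 + 3 * z ^ 2 := fun x y z => by
      nlinarith [sq_nonneg (x + y), sq_nonneg (x - z), sq_nonneg (y + z)]
    have h3 := key (q.1 * dd er v q + (dd et u q - v q)) ((q.1 - 1) * dd er v q) (v q)
    have h4 : q.1 * dd er v q + (dd et u q - v q) - (q.1 - 1) * dd er v q + v q =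
      dd et u q + dd er v q := by ring
    rw [h4, mul_pow] at h3
    nlinarith [mul_le_mul_of_nonneg_right h2 (sq_nonneg (dd er v q))]

theorem nsq_dr_v_le (H : IsShellField L h E u v w) {η : ℝ} (hη : 0 < η) :
    nsq L (1 - h / 2) (1 - h / 2 + h) (dd er v) ≤
      776 * (17 * E + 3 * nsq L (1 - h / 2) (1 - h / 2 + h) v +
        η * nsq L (1 - h / 2) (1 - h / 2 + h) u + 4 * E / (h ^ 2 * η)) := by
  have hE := H.energy_nonneg
  have ht := H.nsq_shear_le
  have hh := H.hh
  have hk := strip_korn (a := 1 - h / 2) (κ := 1) H.hL.le hh (by linarith [H.hh1]) hη (by norm_num)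
    (Or.inl ⟨rfl, H.pu, H.pv⟩) H.hu H.hv
  have cu := H.hu.cont
  have cur := (H.hu.dd er).cont
  have cut := (H.hu.dd et).cont
  have cvr := (H.hv.dd er).cont
  have cvt := (H.hv.dd et).cont
  have e1 : boxInt L (1 - h / 2) (1 - h / 2 + h) (stripDensity h η 1 et u v) =
      nsq L (1 - h / 2) (1 - h / 2 + h) (fun q => dd et u q + dd er v q) +
      nsq L (1 - h / 2) (1 - h / 2 + h) (dd er u) +
      nsq L (1 - h / 2) (1 - h / 2 + h) (fun q => dd et v q + u q) +
      η * nsq L (1 - h / 2) (1 - h / 2 + h) u + (1 / (h ^ 2 * η)) *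
        (nsq L (1 - h / 2) (1 - h / 2 + h) (dd er u) +
        nsq L (1 - h / 2) (1 - h / 2 + h) (fun q => dd et v q + u q)) := by
    unfold nsq
    rw [← boxInt_const_mul, ← boxInt_add (by fun_prop) (by fun_prop),
      ← boxInt_add (by fun_prop) (by fun_prop), ← boxInt_add (by fun_prop) (by fun_prop),
      ← boxInt_add (by fun_prop) (by fun_prop), ← boxInt_const_mul,
      ← boxInt_add (by fun_prop) (by fun_prop)]
    congr 1; funext q; unfold stripDensity; ring
  have e2 : (1 / (h ^ 2 * η)) * (nsq L (1 - h / 2) (1 - h / 2 + h) (dd er u) +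
        nsq L (1 - h / 2) (1 - h / 2 + h) (fun q => dd et v q + u q)) ≤ 4 * E / (h ^ 2 * η) := by
    rw [one_div_mul_eq_div]
    have := H.le_rr
    have := H.le_tt
    exact div_le_div_of_nonneg_right (by linarith) (by positivity)
  rw [e1] at hk
  change nsq L (1 - h / 2) (1 - h / 2 + h) (dd er v) ≤ _ at hk
  have hY := nsq_nonneg (L := L) (a := 1 - h / 2) (b := 1 - h / 2 + h) (f := dd er v)
  have hsmall : 388 * 3 * (h ^ 2 / 4) ≤ 1 / 2 := by nlinarith [H.hh1]
  have := mul_le_mul_of_nonneg_right hsmall hY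
  linarith [H.le_rr, H.le_tt]

theorem nsq_rot_le (H : IsShellField L h E u v w) :
    nsq L (1 - h / 2) (1 - h / 2 + h) (fun q => dd et u q - v q) ≤
      9 * E + 9 / 2 * nsq L (1 - h / 2) (1 - h / 2 + h) (dd er v) := by
  have cut := (H.hu.dd et).cont
  have cvr := (H.hv.dd er).cont
  have cv := H.hv.cont
  have h1 := nsq_sub_le (L := L) (a := 1 - h / 2) (b := 1 - h / 2 + h)
    (g₁ := fun q => q.1 * dd er v q + (dd et u q - v q)) (g₂ := fun q => q.1 * dd er v q)
    (by fun_prop) (by fun_prop)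
  have h2 := H.nsq_fst_mul_le cvr
  simp only [add_sub_cancel_left] at h1
  linarith [H.le_rt]

theorem nsq_u_le (H : IsShellField L h E u v w) {μ : ℝ} (hμ : 0 < μ) :
    nsq L (1 - h / 2) (1 - h / 2 + h) u ≤
      9 / 4 * E + 2 * nsq L (1 - h / 2) (1 - h / 2 + h) v +
        μ * nsq L (1 - h / 2) (1 - h / 2 + h) (fun q => dd et u q - v q) +
        nsq L (1 - h / 2) (1 - h / 2 + h) v / μ := by
  set a := 1 - h / 2
  set b := a + h
  obtain ⟨-, -, -, hu, hv, -, pu, pv, -, -, -, -, le_tt, -⟩ := H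
  have cu := hu.cont
  have cv := hv.cont
  have cut := (hu.dd et).cont
  have cvt := (hv.dd et).cont
  have e1 : nsq L a b u = ip L a b u (fun q => dd et v q + u q) - ip L a b u (dd et v) := by
    rw [← ip_sub_right cu (by fun_prop) cvt, ← ip_self]
    congr 1; funext q; ring
  have e2 : ip L a b (dd et u) v = ip L a b (fun q => dd et u q - v q) v + nsq L a b v := by
    rw [ip_sub_left cv cut cv, ip_self]; ring
  have e3 := ip_dd_t (L := L) (a := a) (b := b) hu hv pu pv
  have e4 := abs_ip_le_of (L := L) (a := a) (b := b) one_pos cu (by fun_prop) le_rfl le_tt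
  have e5 := abs_ip_le (L := L) (a := a) (b := b) hμ (f := fun q => dd et u q - v q)
    (by fun_prop) cv
  have e6 : 1 / (2 * μ) * nsq L a b v = 1 / 2 * (nsq L a b v / μ) := by field_simp
  rw [e6] at e5
  rw [abs_le] at e4 e5
  linarith [e4.2, e5.2]

end IsShellField

/-- The closed system of inequalities behind the first two scalings. -/
theorem scaling_system (L : ℝ) : ∃ K : ℝ, 1 ≤ K ∧ ∀ s E U X V Y D : ℝ, 0 < s → s ≤ 1 → 0 ≤ E →
    0 ≤ U → 0 ≤ X → (∀ δ, 0 < δ → X ≤ 9 * E + δ * U + 9 / 4 * E / δ) → V ≤ 16 * L ^ 2 * X →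
    (∀ η, 0 < η → Y ≤ 776 * (17 * E + 3 * V + η * U + 4 * E / ((s ^ 2) ^ 2 * η))) →
    D ≤ 9 * E + 9 / 2 * Y → (∀ μ, 0 < μ → U ≤ 9 / 4 * E + 2 * V + μ * D + V / μ) →
    U * s ^ 2 ≤ K * E ∧ X * s ≤ K * E ∧ V * s ≤ K * E ∧ Y * s ^ 3 ≤ K * E ∧
      D * s ^ 3 ≤ K * E := by
  obtain ⟨M, hM⟩ : ∃ M, M = 1 + L ^ 2 := ⟨_, rfl⟩
  have hM1 : 1 ≤ M := by nlinarith [sq_nonneg L]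
  have hM0 : 0 < M := by linarith
  refine ⟨10 ^ 17 * M ^ 2, by nlinarith, ?_⟩
  intro s E U X V Y D hs hs1 hE hU hX0 hX hV hY hD hU2
  have p2 : s ^ 2 ≤ 1 := pow_le_one₀ hs.le hs1
  have p3 : s ^ 3 ≤ 1 := pow_le_one₀ hs.le hs1
  have p3s : s ^ 3 ≤ s := by nlinarith
  have p2s : s ^ 2 ≤ s := by nlinarith
  have q2 : 0 < s ^ 2 := by positivity
  have q3 : 0 < s ^ 3 := by positivity
  have a1 : X * s ≤ 9 * E + U * s ^ 2 / (700000 * M) + 9 / 4 * (700000 * M) * E := by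
    have h1 := mul_le_mul_of_nonneg_right (hX (s / (700000 * M)) (by positivity)) hs.le
    have h2 : (9 * E + s / (700000 * M) * U + 9 / 4 * E / (s / (700000 * M))) * s =
        9 * E * s + U * s ^ 2 / (700000 * M) + 9 / 4 * (700000 * M) * E := by
      field_simp
    rw [h2] at h1
    have es1 : E * s ≤ E := mul_le_of_le_one_right hE hs1
    linarith
  have a2 : V * s ≤ 16 * M * (X * s) := by
    have h1 := mul_le_mul_of_nonneg_right hV hs.le
    have h2 := mul_nonneg hX0 hs.le
    rw [hM]
    linarith
  have a3 : V * s ≤ 16 * M * (9 * E + 9 / 4 * (700000 * M) * E) + 16 / 700000 * (U * s ^ 2) := by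
    have h1 := mul_le_mul_of_nonneg_left a1 (by positivity : 0 ≤ 16 * M)
    have h2 : 16 * M * (9 * E + U * s ^ 2 / (700000 * M) + 9 / 4 * (700000 * M) * E) =
        16 * M * (9 * E + 9 / 4 * (700000 * M) * E) + 16 / 700000 * (U * s ^ 2) := by
      field_simp; ring
    linarith
  have hVpos : V * s ^ 3 ≤ max (V * s) 0 ∧ V * s ^ 2 ≤ max (V * s) 0 := by
    rcases le_total 0 V with h | h
    · exact ⟨(mul_le_mul_of_nonneg_left p3s h).trans (le_max_left _ _),
        (mul_le_mul_of_nonneg_left p2s h).trans (le_max_left _ _)⟩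
    · exact ⟨(mul_nonpos_of_nonpos_of_nonneg h q3.le).trans (le_max_right _ _),
        (mul_nonpos_of_nonpos_of_nonneg h q2.le).trans (le_max_right _ _)⟩
  obtain ⟨B, hB⟩ : ∃ B, B = 16 * M * (9 * E + 9 / 4 * (700000 * M) * E) +
    16 / 700000 * (U * s ^ 2) := ⟨_, rfl⟩
  rw [← hB] at a3
  have hB0 : 0 ≤ B := by rw [hB]; positivity
  have es1 : E * s ≤ E := mul_le_of_le_one_right hE hs1
  have es2 : E * s ^ 2 ≤ E := mul_le_of_le_one_right hE p2
  have es3 : E * s ^ 3 ≤ E := mul_le_of_le_one_right hE p3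
  have hmax : max (V * s) 0 ≤ B := max_le a3 hB0
  have a4 : Y * s ^ 3 ≤ 776 * (17 * E + 3 * B + U * s ^ 2 / 14000 + 56000 * E) := by
    have h1 := mul_le_mul_of_nonneg_right (hY (1 / (14000 * s)) (by positivity)) q3.le
    have h2 : 776 * (17 * E + 3 * V + 1 / (14000 * s) * U + 4 * E / ((s ^ 2) ^ 2 *
        (1 / (14000 * s)))) * s ^ 3 =
        776 * (17 * E * s ^ 3 + 3 * (V * s ^ 3) + U * s ^ 2 / 14000 + 56000 * E) := by
      field_simp; ring
    rw [h2] at h1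
    linarith [hVpos.1]
  have a5 : D * s ^ 3 ≤ 9 * E + 9 / 2 * (Y * s ^ 3) := by
    have h1 := mul_le_mul_of_nonneg_right hD q3.le
    linarith
  have a6 : U * s ^ 2 ≤ 9 / 4 * E + 3 * B + D * s ^ 3 := by
    have h1 := mul_le_mul_of_nonneg_right (hU2 s hs) q2.le
    have h2 : (9 / 4 * E + 2 * V + s * D + V / s) * s ^ 2 =
        9 / 4 * E * s ^ 2 + 2 * (V * s ^ 2) + D * s ^ 3 + V * s := by
      field_simp
    rw [h2] at h1
    linarith [hVpos.2]
  have m1 : E ≤ M * E := by nlinarith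
  have m2 : M * E ≤ M ^ 2 * E := by nlinarith [mul_nonneg hM0.le hE]
  have hB' : B = 144 * (M * E) + 25200000 * (M ^ 2 * E) + 16 / 700000 * (U * s ^ 2) := by
    rw [hB]; ring
  have a7 : U * s ^ 2 ≤ 10 ^ 13 * (M ^ 2 * E) := by linarith
  have a8 : U * s ^ 2 / (700000 * M) ≤ U * s ^ 2 :=
    div_le_self (by positivity) (by linarith)
  rw [mul_assoc]
  refine ⟨?_, ?_, ?_, ?_, ?_⟩ <;> linarith

/-- The scalings of the quadratic quantities controlled directly by the energy. -/
theorem basic_bounds (L : ℝ) : ∃ K : ℝ, 1 ≤ K ∧ ∀ (s E : ℝ) (u v w : ℝ × ℝ × ℝ → ℝ), 0 < s →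
    IsShellField L (s ^ 2) E u v w →
    nsq L (1 - s ^ 2 / 2) (1 - s ^ 2 / 2 + s ^ 2) (dd ez v) * s ≤ K * E ∧
    nsq L (1 - s ^ 2 / 2) (1 - s ^ 2 / 2 + s ^ 2) (dd et w) * s ≤ K * E ∧
    nsq L (1 - s ^ 2 / 2) (1 - s ^ 2 / 2 + s ^ 2) (fun q => dd et u q - v q) * s ^ 3 ≤ K * E ∧
    nsq L (1 - s ^ 2 / 2) (1 - s ^ 2 / 2 + s ^ 2) (dd et u) * s ^ 3 ≤ K * E ∧
    nsq L (1 - s ^ 2 / 2) (1 - s ^ 2 / 2 + s ^ 2) (fun q => dd et u q + dd er v q) * s ≤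
      K * E := by
  obtain ⟨K, hK, h⟩ := scaling_system L
  refine ⟨20 * K, by linarith, ?_⟩
  intro s E u v w hs H
  have hE := H.energy_nonneg
  have hs1 : s ≤ 1 := by nlinarith [H.hh1]
  have hP := poincare (a := 1 - s ^ 2 / 2) (b := 1 - s ^ 2 / 2 + s ^ 2) H.hL.le H.hv H.bv
  have X1 : 0 ≤ nsq L (1 - s ^ 2 / 2) (1 - s ^ 2 / 2 + s ^ 2) (dd ez v) := nsq_nonneg
  have X2 : 0 ≤ nsq L (1 - s ^ 2 / 2) (1 - s ^ 2 / 2 + s ^ 2) (dd et w) := nsq_nonneg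
  have hV : nsq L (1 - s ^ 2 / 2) (1 - s ^ 2 / 2 + s ^ 2) v ≤ 16 * L ^ 2 *
      (1 / 4 * nsq L (1 - s ^ 2 / 2) (1 - s ^ 2 / 2 + s ^ 2) (dd ez v) +
        nsq L (1 - s ^ 2 / 2) (1 - s ^ 2 / 2 + s ^ 2) (dd et w)) := by
    have := mul_nonneg (sq_nonneg L) X2
    linarith
  obtain ⟨-, b2, b3, b4, b5⟩ := h s E _ _ _ _ _ hs hs1 hE nsq_nonneg (by positivity)
    (fun δ hδ => H.nsq_dz_v_le hδ) hV (fun η hη => H.nsq_dr_v_le hη) H.nsq_rot_le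
    (fun μ hμ => H.nsq_u_le hμ)
  have cut := (H.hu.dd et).cont
  have cv := H.hv.cont
  have h1 := nsq_add_le (L := L) (a := 1 - s ^ 2 / 2) (b := 1 - s ^ 2 / 2 + s ^ 2)
    (g₁ := fun q => dd et u q - v q) (g₂ := v) (by fun_prop) cv
  simp only [sub_add_cancel] at h1
  have h2 := H.nsq_shear_le
  have hV0 : 0 ≤ nsq L (1 - s ^ 2 / 2) (1 - s ^ 2 / 2 + s ^ 2) v := nsq_nonneg
  have hY0 : 0 ≤ nsq L (1 - s ^ 2 / 2) (1 - s ^ 2 / 2 + s ^ 2) (dd er v) := nsq_nonneg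
  have s3 : s ^ 3 ≤ s := by nlinarith [sq_nonneg s]
  have s5 : s ^ 5 ≤ s ^ 3 := pow_le_pow_of_le_one hs.le hs1 (by norm_num)
  have h3 := mul_le_mul_of_nonneg_left s3 hV0
  have h4 := mul_le_mul_of_nonneg_left s5 hY0
  have h5 := mul_le_mul_of_nonneg_right h1 (pow_pos hs 3).le
  have h6 := mul_le_mul_of_nonneg_right h2 hs.le
  have hKE : E ≤ K * E := le_mul_of_one_le_left hE hK
  have h7 : E * s ≤ E := mul_le_of_le_one_right hE hs1
  have h8 := mul_nonneg X1 hs.le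
  have h9 := mul_nonneg X2 hs.le
  have e1 : 3 * (9 / 2 * E + (s ^ 2) ^ 2 / 4 *
      nsq L (1 - s ^ 2 / 2) (1 - s ^ 2 / 2 + s ^ 2) (dd er v) +
        nsq L (1 - s ^ 2 / 2) (1 - s ^ 2 / 2 + s ^ 2) v) * s = 27 / 2 * (E * s) +
      3 / 4 * (nsq L (1 - s ^ 2 / 2) (1 - s ^ 2 / 2 + s ^ 2) (dd er v) * s ^ 5) +
      3 * (nsq L (1 - s ^ 2 / 2) (1 - s ^ 2 / 2 + s ^ 2) v * s) := by ring
  rw [e1] at h6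
  rw [mul_assoc 20 K E]
  have h1' : nsq L (1 - s ^ 2 / 2) (1 - s ^ 2 / 2 + s ^ 2) (dd et u) ≤ 2 *
      nsq L (1 - s ^ 2 / 2) (1 - s ^ 2 / 2 + s ^ 2) (fun q => dd et u q - v q) +
      2 * nsq L (1 - s ^ 2 / 2) (1 - s ^ 2 / 2 + s ^ 2) v := h1
  have h5' := mul_le_mul_of_nonneg_right h1' (pow_pos hs 3).le
  refine ⟨?_, ?_, ?_, ?_, ?_⟩ <;> linarith

/-! ### The oscillation argument -/

section Oscillation

variable {L a b : ℝ}

theorem abs_ip_mul_le {f g : ℝ × ℝ × ℝ → ℝ} {p r A : ℝ} (hp : 0 < p) (hr : 0 < r)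
    (hf : Continuous f) (hg : Continuous g) (h₁ : nsq L a b f * p ^ 2 ≤ A)
    (h₂ : nsq L a b g * r ^ 2 ≤ A) : |ip L a b f g| * (p * r) ≤ A := by
  have h := mul_le_mul_of_nonneg_right
    (abs_ip_le (L := L) (a := a) (b := b) (div_pos hp hr) hf hg) (mul_pos hp hr).le
  have e : (p / r / 2 * nsq L a b f + 1 / (2 * (p / r)) * nsq L a b g) * (p * r) =
      1 / 2 * (nsq L a b f * p ^ 2) + 1 / 2 * (nsq L a b g * r ^ 2) := by
    field_simp
  linarith

theorem ip_dz_le {M N U V W α β : ℝ × ℝ × ℝ → ℝ} {x A : ℝ} (hL : 0 ≤ L) (hx : 0 < x)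
    (hM : Smooth M) (hN : Smooth N) (hU : Smooth U) (hV : Smooth V) (hW : Smooth W)
    (hα : Smooth α) (hβ : Smooth β) (pM : Periodic3 M) (pN : Periodic3 N) (pU : Periodic3 U)
    (pV : Periodic3 V) (pW : Periodic3 W) (pα : Periodic3 α) (pβ : Periodic3 β)
    (bV : VanZ L V) (bN : VanZ L N) (bβ : VanZ L β ∨ VanZ L W)
    (eα : ∀ q, α q = dd ez U q + M q) (eβ : ∀ q, β q = dd et U q + N q)
    (h₁ : nsq L a b (dd ez M) * (x ^ 4) ^ 2 ≤ A)
    (h₂ : nsq L a b (dd et N) * (x ^ 4) ^ 2 ≤ A)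
    (h₃ : nsq L a b (fun q => dd et M q + dd ez N q) * (x ^ 4) ^ 2 ≤ A)
    (h₄ : nsq L a b (dd et U) * (x ^ 3) ^ 2 ≤ A)
    (h₅ : nsq L a b (fun q => dd et V q + U q) ≤ A)
    (h₆ : nsq L a b (fun q => dd ez V q + dd et W q) ≤ A)
    (h₇ : nsq L a b (dd ez W) ≤ A) (h₈ : nsq L a b (dd et W) * x ^ 2 ≤ A)
    (h₉ : nsq L a b α ≤ A) (h₁₀ : nsq L a b β * x ^ 2 ≤ A) :
    ip L a b (dd ez M) U * x ^ 4 ≤ 10 * A := by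
  have hA : 0 ≤ A := nsq_nonneg.trans h₉
  have cMz := (hM.dd ez).cont
  have cMt := (hM.dd et).cont
  have cNz := (hN.dd ez).cont
  have cNt := (hN.dd et).cont
  have cU := hU.cont
  have cVt := (hV.dd et).cont
  have cVz := (hV.dd ez).cont
  have cWt := (hW.dd et).cont
  have cWz := (hW.dd ez).cont
  have cα := hα.cont
  have cβ := hβ.cont
  have hx4 : 0 < x ^ 4 := by positivity
  have hx3 : 0 < x ^ 3 := by positivity
  have hQ : Smooth fun q => dd et V q + U q := ContDiff.add (hV.dd et) hU
  have hC : Smooth fun q => dd ez V q + dd et W q := ContDiff.add (hV.dd ez) (hW.dd et)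
  have pQ : Periodic3 fun q => dd et V q + U q := fun q => by simp only [pV.dd et q, pU q]
  have pC : Periodic3 fun q => dd ez V q + dd et W q := fun q => by
    simp only [pV.dd ez q, pW.dd et q]
  -- the mixed derivative of `M`
  have hMt : nsq L a b (dd et M) * (x ^ 4) ^ 2 ≤ 3 * A := by
    have e1 : nsq L a b (fun q => dd et M q + dd ez N q) =
        nsq L a b (dd et M) + nsq L a b (dd ez N) + 2 * ip L a b (dd et M) (dd ez N) := by
      unfold nsq ip
      rw [← boxInt_const_mul, ← boxInt_add (by fun_prop) (by fun_prop),
        ← boxInt_add (by fun_prop) (by fun_prop)]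
      congr 1; funext q; ring
    have e2 := ip_cross (a := a) (b := b) hL hM hN pM pN (Or.inr bN)
    have e3 := abs_ip_mul_le hx4 hx4 cMz cNt h₁ h₂
    rw [e1, ← e2] at h₃
    have e4 : 0 ≤ nsq L a b (dd ez N) * (x ^ 4) ^ 2 := mul_nonneg nsq_nonneg (sq_nonneg _)
    have e5 := mul_le_mul_of_nonneg_right (neg_abs_le (ip L a b (dd ez M) (dd et N)))
      (mul_pos hx4 hx4).le
    linarith
  -- a time at which the boundary layer terms are small
  have hder : ∀ t, HasDerivAt
      (fun t => ip L a b α (shift t (dd et W)) - ip L a b β (shift t (dd ez W)))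
      (ip L a b α (shift t (dd et (dd et W))) - ip L a b β (shift t (dd et (dd ez W)))) t :=
    fun t => (hasDerivAt_ip_shift cα (hW.dd et) t).sub (hasDerivAt_ip_shift cβ (hW.dd ez) t)
  have hR : ∀ t, |ip L a b α (shift t (dd et W)) - ip L a b β (shift t (dd ez W))| * x ≤
      2 * A := by
    intro t
    have r1 := abs_ip_mul_le (L := L) (a := a) (b := b) (A := A) one_pos hx cα
      ((hW.dd et).shift t).cont (by simpa using h₉)
      (by rw [nsq_shift cWt (pW.dd et)]; exact h₈)
    have r2 := abs_ip_mul_le (L := L) (a := a) (b := b) (A := A) hx one_pos cβ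
      ((hW.dd ez).shift t).cont h₁₀
      (by rw [nsq_shift cWz (pW.dd ez)]; simpa using h₇)
    have r3 := mul_le_mul_of_nonneg_right (abs_sub (ip L a b α (shift t (dd et W)))
      (ip L a b β (shift t (dd ez W)))) hx.le
    linarith
  obtain ⟨t, ⟨ht0, ht1⟩, ht⟩ := exists_hasDerivAt_eq_slope _ _ hx3
    (fun t _ => (hder t).continuousAt.continuousWithinAt) (fun t _ => hder t)
  have hR' : |ip L a b α (shift t (dd et (dd et W))) - ip L a b β (shift t (dd et (dd ez W)))| *
      x ^ 4 ≤ 4 * A := by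
    rw [ht, sub_zero, abs_div, abs_of_pos hx3, div_mul_eq_mul_div, div_le_iff₀ hx3]
    have r1 := mul_le_mul_of_nonneg_right (abs_sub
      (ip L a b α (shift (x ^ 3) (dd et W)) - ip L a b β (shift (x ^ 3) (dd ez W)))
      (ip L a b α (shift 0 (dd et W)) - ip L a b β (shift 0 (dd ez W)))) hx.le
    have r2 := hR (x ^ 3)
    have r3 := hR 0
    have r4 := mul_le_mul_of_nonneg_right (r1.trans (by linarith) : _ ≤ 4 * A) hx3.le
    linarith
  -- comparison of the times `0` and `t`
  have hg : |ip L a b (dd ez M) (shift t U) - ip L a b (dd ez M) (shift 0 U)| * x ^ 4 ≤ A := by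
    have r0 : ∀ s, |ip L a b (dd ez M) (shift s (dd et U))| ≤ A / x ^ 7 := fun s => by
      rw [le_div_iff₀ (by positivity)]
      have := abs_ip_mul_le hx4 hx3 cMz ((hU.dd et).shift s).cont h₁
        (by rw [nsq_shift (hU.dd et).cont (pU.dd et)]; exact h₄)
      linarith
    have r1 := Convex.norm_image_sub_le_of_norm_hasDerivWithin_le (s := Set.univ) (x := (0 : ℝ))
      (y := t) (fun s _ => (hasDerivAt_ip_shift cMz hU s).hasDerivWithinAt)
      (fun s _ => r0 s) convex_univ trivial trivial
    rw [sub_zero, Real.norm_eq_abs, Real.norm_eq_abs, abs_of_pos ht0] at r1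
    have r2 := mul_le_mul_of_nonneg_left ht1.le (by positivity : 0 ≤ A / x ^ 7)
    have r3 := mul_le_mul_of_nonneg_right (r1.trans r2) hx4.le
    have r4 : A / x ^ 7 * x ^ 3 * x ^ 4 = A := by field_simp
    linarith
  have s0 : shift 0 U = U := by funext q; simp [shift]
  rw [s0] at hg
  -- the identity at time `t`
  have i1 : ip L a b (dd ez M) (shift t U) =
      ip L a b (dd ez M) (shift t fun q => dd et V q + U q) -
        ip L a b (dd ez M) (dd et (shift t V)) := by
    rw [← ip_sub_right cMz (hQ.shift t).cont ((hV.shift t).dd et).cont]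
    congr 1; funext q; rw [dd_shift]; simp [shift]
  have i2 := ip_cross (a := a) (b := b) hL hM (hV.shift t) pM (pV.shift t) (Or.inr (bV.shift t))
  have i3 : ip L a b (dd et M) (dd ez (shift t V)) =
      ip L a b (dd et M) (shift t fun q => dd ez V q + dd et W q) -
        ip L a b (dd et M) (dd et (shift t W)) := by
    rw [← ip_sub_right cMt (hC.shift t).cont ((hW.shift t).dd et).cont]
    congr 1; funext q; rw [dd_shift, dd_shift]; simp [shift]
  have eM : ∀ q, dd et M q = dd ez N q + (dd et α q - dd ez β q) := by
    intro q
    have e1 : α = fun q => dd ez U q + M q := funext eα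
    have e2 : β = fun q => dd et U q + N q := funext eβ
    rw [e1, e2, dd_add (hU.dd ez) hM, dd_add (hU.dd et) hN, dd_comm hU]
    ring
  have cαt := (hα.dd et).cont
  have cβz := (hβ.dd ez).cont
  have i4 : ip L a b (dd et M) (dd et (shift t W)) =
      ip L a b (dd ez N) (dd et (shift t W)) + (ip L a b (dd et α) (dd et (shift t W)) -
        ip L a b (dd ez β) (dd et (shift t W))) := by
    have cs := ((hW.shift t).dd et).cont
    unfold ip
    rw [← boxInt_sub (by fun_prop) (by fun_prop), ← boxInt_add (by fun_prop) (by fun_prop)]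
    congr 1; funext q; rw [eM]; ring
  have i5 := ip_cross (a := a) (b := b) hL hN (hW.shift t) pN (pW.shift t) (Or.inl bN)
  have i6 := ip_cross (a := a) (b := b) hL hβ (hW.shift t) pβ (pW.shift t)
    (bβ.imp_right fun h => h.shift t)
  have i7 := ip_dd_t (L := L) (a := a) (b := b) hα ((hW.shift t).dd et) pα ((pW.shift t).dd et)
  have i8 := ip_dd_t (L := L) (a := a) (b := b) hβ ((hW.shift t).dd ez) pβ ((pW.shift t).dd ez)
  have d1 : ∀ e, dd e (shift t W) = shift t (dd e W) := fun e => funext fun q => dd_shift t q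
  have d2 : ∀ e, dd et (shift t (dd e W)) = shift t (dd et (dd e W)) := fun e =>
    funext fun q => dd_shift t q
  rw [d1, d2] at i7 i8
  rw [d1, d1] at i5 i6
  rw [d1] at i4
  rw [d1] at i3
  -- the remaining terms
  have hx5 : (0 : ℝ) < x ^ 4 * 1 := by positivity
  have j1 := abs_ip_mul_le (L := L) (a := a) (b := b) (A := A) hx4 one_pos cMz
    (hQ.shift t).cont h₁ (by rw [nsq_shift hQ.cont pQ]; simpa using h₅)
  have j2 := abs_ip_mul_le (L := L) (a := a) (b := b) (A := 3 * A) hx4 one_pos cMt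
    (hC.shift t).cont hMt (by rw [nsq_shift hC.cont pC, one_pow, mul_one]; linarith)
  have j3 := abs_ip_mul_le (L := L) (a := a) (b := b) (A := A) hx4 one_pos cNt
    ((hW.dd ez).shift t).cont h₂ (by rw [nsq_shift cWz (pW.dd ez)]; simpa using h₇)
  have lo : ∀ {y c B : ℝ}, 0 < c → |y| * c ≤ B → y * c ≤ B ∧ -(y * c) ≤ B := by
    intro y c B hc h
    constructor
    · exact (mul_le_mul_of_nonneg_right (le_abs_self y) hc.le).trans h
    · rw [← neg_mul]
      exact (mul_le_mul_of_nonneg_right (neg_le_abs y) hc.le).trans h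
  have k0 := (lo hx4 hg).2
  have k1 := (lo hx5 j1).1
  have k2 := (lo hx5 j2).2
  have k3 := (lo hx5 j3).1
  have k4 := (lo hx4 hR').2
  rw [mul_one] at k1 k2 k3
  have e : ip L a b (dd ez M) (shift t U) =
      ip L a b (dd ez M) (shift t fun q => dd et V q + U q) -
      ip L a b (dd et M) (shift t fun q => dd ez V q + dd et W q) +
      ip L a b (dd et N) (shift t (dd ez W)) -
      (ip L a b α (shift t (dd et (dd et W))) - ip L a b β (shift t (dd et (dd ez W)))) := by
    linarith
  rw [e] at k0
  linarith

end Oscillation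

namespace IsShellField

variable {L h E : ℝ} {u v w : ℝ × ℝ × ℝ → ℝ}

/-- Up to its radial average, `∂_r w` is controlled by the energy. -/
theorem nsq_dr_w_sub_av_le (H : IsShellField L h E u v w) :
    nsq L (1 - h / 2) (1 - h / 2 + h) (fun q => dd er w q - av (1 - h / 2) h (dd er w) q) ≤
      40000 * E := by
  have hh := H.hh
  have H' := H
  obtain ⟨hL, -, hh1, hu, hv, hw, -, -, -, -, buw, le_rr, -, le_zz, le_rz, -, -⟩ := H'
  set a := 1 - h / 2 with ha
  have hwr := hw.dd er
  have hwz := hw.dd ez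
  have huz := hu.dd ez
  have hr : Smooth fun q : ℝ × ℝ × ℝ => q.1 - 1 := by unfold Smooth; fun_prop
  have hrM : Smooth fun q => (q.1 - 1) * av a h (dd er w) q := ContDiff.mul hr hwr.av
  have hwA : Smooth fun q => w q - av a h w q := ContDiff.sub hw hw.av
  have hu' : Smooth fun q => u q - av a h u q := ContDiff.sub hu hu.av
  have hw' : Smooth fun q => w q - av a h w q - (q.1 - 1) * av a h (dd er w) q :=
    ContDiff.sub hwA hrM
  have dr1 : ∀ e q, dd e (fun q : ℝ × ℝ × ℝ => q.1 - 1) q = e.1 := fun e q => by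
    have := dd_fst_affine (e := e) 1 (-1) q
    simpa [← sub_eq_add_neg] using this
  have e1 : ∀ q, dd er (fun q => u q - av a h u q) q = dd er u q := fun q => by
    rw [dd_sub hu hu.av, dd_er_av hu, sub_zero]
  have e2 : ∀ q, dd ez (fun q => u q - av a h u q) q = dd ez u q - av a h (dd ez u) q := fun q => by
    rw [dd_sub hu hu.av, dd_av hu rfl]
  have e3 : ∀ q, dd er (fun q => w q - av a h w q - (q.1 - 1) * av a h (dd er w) q) q =
      dd er w q - av a h (dd er w) q := fun q => by
    rw [dd_sub hwA hrM, dd_sub hw hw.av, dd_mul hr hwr.av, dd_er_av hw, dd_er_av hwr, dr1]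
    simp [er]
  have e4 : ∀ q, dd ez (fun q => w q - av a h w q - (q.1 - 1) * av a h (dd er w) q) q =
      dd ez w q - av a h (dd ez w) q - (q.1 - 1) * av a h (dd er (dd ez w)) q := fun q => by
    rw [dd_sub hwA hrM, dd_sub hw hw.av, dd_mul hr hwr.av, dd_av hw rfl, dd_av hwr rfl, dr1,
      dd_comm hw]
    simp [ez]
  have hk := strip_korn (a := a) (κ := 0) (η := 1 / h ^ 2) (e := ez) hL.le hh (by linarith)
    (by positivity) (by norm_num)
    (Or.inr ⟨rfl, buw.imp (fun b r θ => ?_) (fun b r θ => ?_)⟩) hu' hw'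
  rotate_left
  · simp [(b r θ).1, (b r θ).2, (b.av r θ).1, (b.av r θ).2]
  · have b' := (b.dd hw (e := er) rfl).av (a := a) (h := h) r θ
    simp [(b r θ).1, (b r θ).2, (b.av r θ).1, (b.av r θ).2, b'.1, b'.2]
  have hσ : Smooth fun q => dd ez u q + dd er w q := ContDiff.add huz hwr
  have cσ := hσ.cont
  have cσA := (hσ.av (a := a) (h := h)).cont
  have cu := hu.cont
  have cuA := (hu.av (a := a) (h := h)).cont
  have cur := (hu.dd er).cont
  have cwz := hwz.cont
  have cwzA := (hwz.av (a := a) (h := h)).cont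
  have cwzr := ((hwz.dd er).av (a := a) (h := h)).cont
  have e5 : boxInt L a (a + h) (stripDensity h (1 / h ^ 2) 0 ez (fun q => u q - av a h u q)
      fun q => w q - av a h w q - (q.1 - 1) * av a h (dd er w) q) =
      nsq L a (a + h) (fun q => (dd ez u q + dd er w q) -
        av a h (fun q => dd ez u q + dd er w q) q) + 2 * nsq L a (a + h) (dd er u) +
      2 * nsq L a (a + h) (fun q => dd ez w q - av a h (dd ez w) q -
        (q.1 - 1) * av a h (dd er (dd ez w)) q) +
      1 / h ^ 2 * nsq L a (a + h) (fun q => u q - av a h u q) := by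
    unfold nsq
    rw [← boxInt_const_mul, ← boxInt_const_mul, ← boxInt_const_mul,
      ← boxInt_add (by fun_prop) (by fun_prop), ← boxInt_add (by fun_prop) (by fun_prop),
      ← boxInt_add (by fun_prop) (by fun_prop)]
    congr 1; funext q
    unfold stripDensity
    rw [e1, e2, e3, e4]
    beta_reduce
    rw [av_add huz hwr]
    field_simp
    ring
  simp only [e3] at hk
  rw [e5] at hk
  have f1 := nsq_sub_le (L := L) (a := a) (b := a + h) cσ cσA
  have f2 : nsq L a (a + h) (av a h fun q => dd ez u q + dd er w q) ≤ _ :=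
    boxInt_av_sq_le (L := L) hh hσ
  change _ ≤ 9 / 4 * nsq L a (a + h) (fun q => dd ez u q + dd er w q) at f2
  have f3 := nsq_le₃ (L := L) (a := a) (b := a + h) (f := fun q => dd ez w q -
    av a h (dd ez w) q - (q.1 - 1) * av a h (dd er (dd ez w)) q) (g₁ := dd ez w)
    (g₂ := av a h (dd ez w)) (g₃ := av a h (dd er (dd ez w))) (c₁ := 3) (c₂ := 3)
    (c₃ := 3 * (h ^ 2 / 4)) (by fun_prop) cwz cwzA cwzr ?_
  · have f4 : nsq L a (a + h) (av a h (dd ez w)) ≤ 9 / 4 * nsq L a (a + h) (dd ez w) :=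
      boxInt_av_sq_le (L := L) hh hwz
    have f5 : nsq L a (a + h) (av a h (dd er (dd ez w))) ≤
        36 / h ^ 2 * nsq L a (a + h) (dd ez w) := boxInt_av_dr_sq_le (L := L) hh hwz
    have f6 : nsq L a (a + h) (fun q => u q - av a h u q) ≤
        9 / 4 * h ^ 2 * nsq L a (a + h) (dd er u) := boxInt_sub_av_sq_le (L := L) hh hu
    have f7 := mul_le_mul_of_nonneg_left f5 (by positivity : 0 ≤ 3 * (h ^ 2 / 4))
    have f8 := mul_le_mul_of_nonneg_left f6 (by positivity : 0 ≤ 1 / h ^ 2)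
    have g1 : 3 * (h ^ 2 / 4) * (36 / h ^ 2 * nsq L a (a + h) (dd ez w)) =
        27 * nsq L a (a + h) (dd ez w) := by field_simp; ring
    have g2 : 1 / h ^ 2 * (9 / 4 * h ^ 2 * nsq L a (a + h) (dd er u)) =
        9 / 4 * nsq L a (a + h) (dd er u) := by field_simp
    rw [g1] at f7
    rw [g2] at f8
    change nsq L a (a + h) (fun q => dd er w q - av a h (dd er w) q) ≤ _ at hk
    linarith [H.energy_nonneg]
  · intro q hq
    have h2 := (H.mem_box hq).2.2
    have key : ∀ x y z : ℝ, (x - y - z) ^ 2 ≤ 3 * x ^ 2 + 3 * y ^ 2 + 3 * z ^ 2 := fun x y z => by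
      nlinarith [sq_nonneg (x + y), sq_nonneg (x + z), sq_nonneg (y - z)]
    have h3 := key (dd ez w q) (av a h (dd ez w) q) ((q.1 - 1) * av a h (dd er (dd ez w)) q)
    have h4 := mul_le_mul_of_nonneg_right h2 (sq_nonneg (av a h (dd er (dd ez w)) q))
    rw [mul_pow (q.1 - 1)] at h3
    linarith

/-- The `z`-derivative of `u` is controlled by the radial average of `∂_r w`. -/
theorem nsq_dz_u_le (H : IsShellField L h E u v w) :
    nsq L (1 - h / 2) (1 - h / 2 + h) (dd ez u) ≤
      120006 * E + 3 * nsq L (1 - h / 2) (1 - h / 2 + h) (av (1 - h / 2) h (dd er w)) := by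
  have hwr := H.hw.dd er
  have cuz := (H.hu.dd ez).cont
  have cwr := hwr.cont
  have cM := (hwr.av (a := 1 - h / 2) (h := h)).cont
  have h1 := nsq_le₃ (L := L) (a := 1 - h / 2) (b := 1 - h / 2 + h) (f := dd ez u)
    (g₁ := fun q => dd ez u q + dd er w q)
    (g₂ := fun q => dd er w q - av (1 - h / 2) h (dd er w) q) (g₃ := av (1 - h / 2) h (dd er w))
    (c₁ := 3) (c₂ := 3) (c₃ := 3) cuz (by fun_prop) (by fun_prop) cM fun q _ => by
      have key : ∀ x y z : ℝ, (x - y - z) ^ 2 ≤ 3 * x ^ 2 + 3 * y ^ 2 + 3 * z ^ 2 := fun x y z => by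
        nlinarith [sq_nonneg (x + y), sq_nonneg (x + z), sq_nonneg (y - z)]
      have := key (dd ez u q + dd er w q) (dd er w q - av (1 - h / 2) h (dd er w) q)
        (av (1 - h / 2) h (dd er w) q)
      rwa [sub_sub, sub_add_cancel, add_sub_cancel_right] at this
  linarith [H.le_rz, H.nsq_dr_w_sub_av_le]

theorem nsq_av_dr_w_le (H : IsShellField L h E u v w) :
    nsq L (1 - h / 2) (1 - h / 2 + h) (av (1 - h / 2) h (dd er w)) ≤
      9 / 2 * E + 2 * ip L (1 - h / 2) (1 - h / 2 + h) (dd ez (av (1 - h / 2) h (dd er w)))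
        (av (1 - h / 2) h u) := by
  have H' := H
  obtain ⟨hL, hh, -, hu, -, hw, -, -, -, -, buw, -, -, -, le_rz, -, -⟩ := H'
  set a := 1 - h / 2
  have hwr := hw.dd er
  have huz := hu.dd ez
  have hσ : Smooth fun q => dd ez u q + dd er w q := ContDiff.add huz hwr
  have hM := hwr.av (a := a) (h := h)
  have h1 := ip_dd_z (a := a) (b := a + h) hL.le hM (hu.av (a := a) (h := h))
    (buw.symm.imp (fun b => (b.dd hw rfl).av) (fun b => b.av))
  have h2 := abs_ip_le (L := L) (a := a) (b := a + h) one_pos hM.cont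
    (hσ.av (a := a) (h := h)).cont
  have h3 : ip L a (a + h) (av a h (dd er w)) (av a h fun q => dd ez u q + dd er w q) =
      ip L a (a + h) (av a h (dd er w)) (dd ez (av a h u)) +
        nsq L a (a + h) (av a h (dd er w)) := by
    rw [← ip_self, ← ip_add_right hM.cont (hu.av.dd ez).cont hM.cont]
    congr 1; funext q; rw [av_add huz hwr, dd_av hu rfl]
  have h4 : nsq L a (a + h) (av a h fun q => dd ez u q + dd er w q) ≤ _ :=
    boxInt_av_sq_le (L := L) hh hσ
  change _ ≤ 9 / 4 * nsq L a (a + h) (fun q => dd ez u q + dd er w q) at h4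
  have h5 := (le_abs_self _).trans h2
  norm_num at h5
  linarith

end IsShellField

/-- The three scalings for shell fields on a shell of thickness `x ^ 4`. -/
theorem shell_scalings (L : ℝ) : ∃ K : ℝ, 1 ≤ K ∧ ∀ (x E : ℝ) (u v w : ℝ × ℝ × ℝ → ℝ), 0 < x →
    IsShellField L (x ^ 4) E u v w →
    nsq L (1 - x ^ 4 / 2) (1 - x ^ 4 / 2 + x ^ 4) (fun q => dd et u q - v q) * x ^ 6 ≤ K * E ∧
    nsq L (1 - x ^ 4 / 2) (1 - x ^ 4 / 2 + x ^ 4) (dd ez v) * x ^ 2 ≤ K * E ∧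
    nsq L (1 - x ^ 4 / 2) (1 - x ^ 4 / 2 + x ^ 4) (dd ez u) * x ^ 4 ≤ K * E := by
  obtain ⟨K, hK, hb⟩ := basic_bounds L
  refine ⟨60 * (1000 * K) + 130000, by linarith, ?_⟩
  intro x E u v w hx H
  have hE := H.energy_nonneg
  have h4 := H.hh
  have hx1 : x ^ 4 ≤ 1 := by linarith [H.hh1]
  have hs := hb (x ^ 2) E u v w (by positivity)
  rw [← pow_mul, ← pow_mul] at hs
  norm_num at hs
  obtain ⟨b1, b2, b3, b4, b5⟩ := hs H
  have hKE : E ≤ K * E := le_mul_of_one_le_left hE hK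
  refine ⟨by linarith, by linarith, ?_⟩
  have k1 := H.nsq_dz_u_le
  have k2 := H.nsq_av_dr_w_le
  have hmem := fun q hq => (H.mem_box (q := q) hq).2.2
  obtain ⟨hL, -, -, hu, hv, hw, pu, pv, pw, bv, buw, l1, l2, l3, l4, -, l5⟩ := H
  clear b3 hb hs
  generalize hh : x ^ 4 = h at *
  set a := 1 - h / 2 with ha
  have hur := hu.dd er
  have hvr := hv.dd er
  have hwr := hw.dd er
  have huz := hu.dd ez
  have hut := hu.dd et
  have hvt := hv.dd et
  have hvz := hv.dd ez
  have hwt := hw.dd et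
  have hwz := hw.dd ez
  have hq : Smooth fun q => dd et v q + u q := ContDiff.add hvt hu
  have hc : Smooth fun q => dd ez v q + dd et w q := ContDiff.add hvz hwt
  have hσ : Smooth fun q => dd ez u q + dd er w q := ContDiff.add huz hwr
  have ht : Smooth fun q => dd et u q + dd er v q := ContDiff.add hut hvr
  have av2 : ∀ {f : ℝ × ℝ × ℝ → ℝ}, Smooth f →
      nsq L a (a + h) (av a h f) ≤ 9 / 4 * nsq L a (a + h) f := fun hf => boxInt_av_sq_le h4 hf
  have av3 : ∀ {f : ℝ × ℝ × ℝ → ℝ}, Smooth f →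
      nsq L a (a + h) (av a h (dd er f)) * h ^ 2 ≤ 36 * nsq L a (a + h) f := fun {f} hf => by
    have h1 := mul_le_mul_of_nonneg_right (boxInt_av_dr_sq_le (L := L) (a := a) h4 hf)
      (sq_nonneg h)
    have e1 : 36 / h ^ 2 * boxInt L a (a + h) (fun q => f q ^ 2) * h ^ 2 =
        36 * nsq L a (a + h) f := by unfold nsq; field_simp
    exact h1.trans e1.le
  have hc2 : nsq L a (a + h) (fun q => dd ez v q + dd et w q) ≤ 10 * (K * E) := by
    have cvz := hvz.cont
    have cwt := hwt.cont
    have n1 := nsq_le₂ (L := L) (a := a) (b := a + h) (f := fun q => dd ez v q + dd et w q)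
      (g₁ := fun q => q.1 * dd ez v q + dd et w q) (g₂ := dd ez v) (c₁ := 2)
      (c₂ := 2 * (h ^ 2 / 4)) (by fun_prop) (by fun_prop) cvz fun q hq => by
        have n2 := mul_le_mul_of_nonneg_right (hmem q hq) (sq_nonneg (dd ez v q))
        nlinarith [sq_nonneg (q.1 * dd ez v q + dd et w q + (q.1 - 1) * dd ez v q)]
    have n3 : h ^ 2 ≤ x ^ 2 := by
      rw [← hh, ← pow_mul]
      exact pow_le_pow_of_le_one hx.le ((pow_le_one_iff_of_nonneg hx.le (by norm_num)).1
        (hh.trans_le hx1)) (by norm_num)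
    have n4 := mul_le_mul_of_nonneg_left n3 (nsq_nonneg (L := L) (a := a) (b := a + h)
      (f := dd ez v))
    linarith
  have key := ip_dz_le (L := L) (a := a) (b := a + h) (x := x) (A := 1000 * (K * E))
    (M := av a h (dd er w)) (N := av a h (dd er v)) (U := av a h u) (V := av a h v)
    (W := av a h w) (α := av a h fun q => dd ez u q + dd er w q)
    (β := av a h fun q => dd et u q + dd er v q) hL.le hx hwr.av hvr.av hu.av hv.av hw.av
    hσ.av ht.av (pw.dd er).av (pv.dd er).av pu.av pv.av pw.av
    (Periodic3.av fun q => by simp only [pu.dd ez q, pw.dd er q])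
    (Periodic3.av fun q => by simp only [pu.dd et q, pv.dd er q])
    bv.av (bv.dd hv rfl).av
    (buw.imp (fun b => VanZ.av fun r θ => by
      have b' := b.dd hu (e := et) rfl r θ
      have b'' := bv.dd hv (e := er) rfl r θ
      simp [b'.1, b'.2, b''.1, b''.2]) fun b => b.av)
    (fun q => by rw [av_add huz hwr, dd_av hu rfl])
    (fun q => by rw [av_add hut hvr, dd_av hu rfl])
    ?_ ?_ ?_ ?_ ?_ ?_ ?_ ?_ ?_ ?_
  · rw [hh] at key
    have k3 := mul_le_mul_of_nonneg_right k1 h4.le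
    have k4 := mul_le_mul_of_nonneg_right k2 h4.le
    have k5 : E * h ≤ E := mul_le_of_le_one_right hE hx1
    linarith
  · rw [hh, dd_av hwr rfl, dd_comm hw]
    linarith [av3 hwz]
  · rw [hh, dd_av hvr rfl, dd_comm hv]
    have e1 : av a h (dd er (dd et v)) = fun q =>
        av a h (dd er fun q => dd et v q + u q) q - av a h (dd er u) q := by
      funext q
      rw [← av_sub (hq.dd er) hur]
      congr 1; funext q; rw [dd_add hvt hu]; ring
    have m1 := nsq_sub_le (L := L) (a := a) (b := a + h) ((hq.dd er).av (a := a) (h := h)).cont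
      (hur.av (a := a) (h := h)).cont
    rw [← e1] at m1
    have m2 := av3 hq
    have m3 := av2 hur
    have m4 := mul_le_mul_of_nonneg_right m1 (sq_nonneg h)
    have m5 : E * h ^ 2 ≤ E := mul_le_of_le_one_right hE (pow_le_one₀ h4.le hx1)
    have m6 := mul_le_mul_of_nonneg_right (m3.trans (by linarith : _ ≤ 9 / 4 * E)) (sq_nonneg h)
    linarith
  · have e1 : (fun q => dd et (av a h (dd er w)) q + dd ez (av a h (dd er v)) q) =
        av a h (dd er fun q => dd ez v q + dd et w q) := by
      funext q
      rw [dd_av hwr rfl, dd_av hvr rfl, dd_comm hw, dd_comm hv,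
        ← av_add (hwt.dd er) (hvz.dd er)]
      congr 1; funext q; rw [dd_add hvz hwt, add_comm]
    rw [hh, e1]
    linarith [av3 hc]
  · rw [dd_av hu rfl, ← pow_mul]
    have m1 := mul_le_mul_of_nonneg_right (av2 hut) (pow_pos hx 6).le
    norm_num
    linarith
  · have e1 : (fun q => dd et (av a h v) q + av a h u q) =
        av a h fun q => dd et v q + u q := by
      funext q; rw [dd_av hv rfl, av_add hvt hu]
    rw [e1]
    linarith [av2 hq]
  · have e1 : (fun q => dd ez (av a h v) q + dd et (av a h w) q) =
        av a h fun q => dd ez v q + dd et w q := by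
      funext q; rw [dd_av hv rfl, dd_av hw rfl, av_add hvz hwt]
    rw [e1]
    linarith [av2 hc]
  · rw [dd_av hw rfl]
    linarith [av2 hwz]
  · rw [dd_av hw rfl]
    linarith [mul_le_mul_of_nonneg_right (av2 hwt) (sq_nonneg x)]
  · linarith [av2 hσ]
  · linarith [mul_le_mul_of_nonneg_right (av2 ht) (sq_nonneg x)]

/-! ### The main theorem -/

theorem isShellField_of_boundary {L h : ℝ} {u v w : ℝ × ℝ × ℝ → ℝ} (hL : 0 < L) (hh : 0 < h)
    (hh1 : h ≤ 1 / 25) (hu : Smooth u) (hv : Smooth v) (hw : Smooth w) (pu : Periodic3 u)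
    (pv : Periodic3 v) (pw : Periodic3 w) (hbc : BC1 L u v w ∨ BC2 L u v w) :
    IsShellField L h (∫ q in shell h L, eSq u v w q) u v w := by
  have hbox : shell h L = box L (1 - h / 2) (1 - h / 2 + h) := by
    unfold shell box; congr 2; ring
  have hr : ∀ q ∈ box L (1 - h / 2) (1 - h / 2 + h), 49 / 50 ≤ q.1 ∧ q.1 ≤ 51 / 50 :=
    fun q hq => ⟨by linarith [hq.1.1], by linarith [hq.1.2]⟩
  have cu := hu.cont
  have cv := hv.cont
  have cur := (hu.dd er).cont
  have cut := (hu.dd et).cont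
  have cuz := (hu.dd ez).cont
  have cvr := (hv.dd er).cont
  have cvt := (hv.dd et).cont
  have cvz := (hv.dd ez).cont
  have cwr := (hw.dd er).cont
  have cwt := (hw.dd et).cont
  have cwz := (hw.dd ez).cont
  have ce : ContinuousOn (eSq u v w) (box L (1 - h / 2) (1 - h / 2 + h)) := by
    have h0 : ∀ q ∈ box L (1 - h / 2) (1 - h / 2 + h), q.1 ≠ 0 := fun q hq => by
      linarith [(hr q hq).1]
    change ContinuousOn (fun q => (dd er u q) ^ 2 + ((dd et v q + u q) / q.1) ^ 2 +
      (dd ez w q) ^ 2 + 2 * ((dd er v q + (dd et u q - v q) / q.1) / 2) ^ 2 +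
      2 * ((dd ez u q + dd er w q) / 2) ^ 2 + 2 * ((dd ez v q + dd et w q / q.1) / 2) ^ 2) _
    fun_prop (disch := assumption)
  have hle : ∀ {f : ℝ × ℝ × ℝ → ℝ} {c : ℝ}, Continuous f →
      (∀ q ∈ box L (1 - h / 2) (1 - h / 2 + h), f q ^ 2 ≤ c * eSq u v w q) →
      nsq L (1 - h / 2) (1 - h / 2 + h) f ≤ c * ∫ q in shell h L, eSq u v w q := by
    intro f c hf hq
    rw [hbox, ← integral_const_mul]
    exact setIntegral_mono_on
      ((hf.pow 2).continuousOn.integrableOn_compact (isCompact_box _ _ _))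
      ((ce.integrableOn_compact (isCompact_box _ _ _)).const_mul c)
      (isCompact_box _ _ _).measurableSet hq
  have hsc : ∀ q ∈ box L (1 - h / 2) (1 - h / 2 + h), ∀ y : ℝ,
      (q.1 * y) ^ 2 ≤ 9 / 4 * y ^ 2 := fun q hq y => by
    rw [mul_pow]
    exact mul_le_mul_of_nonneg_right (by nlinarith [hr q hq]) (sq_nonneg y)
  have he : ∀ q, eSq u v w q = (dd er u q) ^ 2 + ((dd et v q + u q) / q.1) ^ 2 +
      (dd ez w q) ^ 2 + 2 * ((dd er v q + (dd et u q - v q) / q.1) / 2) ^ 2 +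
      2 * ((dd ez u q + dd er w q) / 2) ^ 2 + 2 * ((dd ez v q + dd et w q / q.1) / 2) ^ 2 :=
    fun q => rfl
  have hbv : VanZ L v ∧ (VanZ L u ∨ VanZ L w) := by
    rcases hbc with b | b
    · exact ⟨fun r θ => ⟨(b r θ).2.1, (b r θ).2.2.2.2⟩,
        Or.inl fun r θ => ⟨(b r θ).1, (b r θ).2.2.2.1⟩⟩
    · exact ⟨fun r θ => ⟨(b r θ).1, (b r θ).2.2.1⟩,
        Or.inr fun r θ => ⟨(b r θ).2.1, (b r θ).2.2.2⟩⟩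
  refine ⟨hL, hh, hh1, hu, hv, hw, pu, pv, pw, hbv.1, hbv.2, ?_, ?_, ?_, ?_, ?_, ?_⟩
  · rw [← one_mul (∫ q in shell h L, eSq u v w q)]
    refine hle cur fun q _ => ?_
    rw [he, one_mul]
    simp only [add_assoc]
    exact le_add_of_nonneg_right (by positivity)
  · refine hle (by fun_prop) fun q hq => ?_
    have h0 : q.1 ≠ 0 := by linarith [(hr q hq).1]
    have h1 := hsc q hq ((dd et v q + u q) / q.1)
    rw [mul_div_cancel₀ _ h0] at h1
    rw [he]
    have : 0 ≤ (dd er u q) ^ 2 + (dd ez w q) ^ 2 +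
      2 * ((dd er v q + (dd et u q - v q) / q.1) / 2) ^ 2 +
      2 * ((dd ez u q + dd er w q) / 2) ^ 2 +
      2 * ((dd ez v q + dd et w q / q.1) / 2) ^ 2 := by positivity
    linarith
  · rw [← one_mul (∫ q in shell h L, eSq u v w q)]
    refine hle cwz fun q _ => ?_
    rw [he]
    have : 0 ≤ (dd er u q) ^ 2 + ((dd et v q + u q) / q.1) ^ 2 +
      2 * ((dd er v q + (dd et u q - v q) / q.1) / 2) ^ 2 +
      2 * ((dd ez u q + dd er w q) / 2) ^ 2 +
      2 * ((dd ez v q + dd et w q / q.1) / 2) ^ 2 := by positivity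
    linarith
  · refine hle (by fun_prop) fun q _ => ?_
    rw [he]
    have : 0 ≤ (dd er u q) ^ 2 + ((dd et v q + u q) / q.1) ^ 2 + (dd ez w q) ^ 2 +
      2 * ((dd er v q + (dd et u q - v q) / q.1) / 2) ^ 2 +
      2 * ((dd ez v q + dd et w q / q.1) / 2) ^ 2 := by positivity
    linarith
  · refine hle (by fun_prop) fun q hq => ?_
    have h0 : q.1 ≠ 0 := by linarith [(hr q hq).1]
    have h1 := hsc q hq (dd er v q + (dd et u q - v q) / q.1)
    rw [mul_add, mul_div_cancel₀ _ h0] at h1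
    rw [he]
    have : 0 ≤ (dd er u q) ^ 2 + ((dd et v q + u q) / q.1) ^ 2 + (dd ez w q) ^ 2 +
      2 * ((dd ez u q + dd er w q) / 2) ^ 2 +
      2 * ((dd ez v q + dd et w q / q.1) / 2) ^ 2 := by positivity
    linarith
  · refine hle (by fun_prop) fun q hq => ?_
    have h0 : q.1 ≠ 0 := by linarith [(hr q hq).1]
    have h1 := hsc q hq (dd ez v q + dd et w q / q.1)
    rw [mul_add, mul_div_cancel₀ _ h0] at h1
    rw [he]
    have : 0 ≤ (dd er u q) ^ 2 + ((dd et v q + u q) / q.1) ^ 2 + (dd ez w q) ^ 2 +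
      2 * ((dd er v q + (dd et u q - v q) / q.1) / 2) ^ 2 +
      2 * ((dd ez u q + dd er w q) / 2) ^ 2 := by positivity
    linarith

/-- Scaling of the gradient components (Theorem 2.3): three distinct power laws
for the components (∇φ)_{rθ}, φ_{θ,z} and φ_{r,z}. -/
theorem gradient_components_scaling :
    ∀ L : ℝ, 0 < L → ∃ C h₀ : ℝ, 0 < C ∧ 0 < h₀ ∧
      ∀ h : ℝ, 0 < h → h < h₀ →
        ∀ fr fθ fz : ℝ × ℝ × ℝ → ℝ,
          ContDiff ℝ (⊤ : ℕ∞) fr → ContDiff ℝ (⊤ : ℕ∞) fθ → ContDiff ℝ (⊤ : ℕ∞) fz →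
          Periodic3 fr → Periodic3 fθ → Periodic3 fz →
          (BC1 L fr fθ fz ∨ BC2 L fr fθ fz) →
          (∫ q in shell h L, ((dth fr q - fθ q)/q.1)^2)
              ≤ C * h ^ (-(3:ℝ)/2) * (∫ q in shell h L, eSq fr fθ fz q) ∧
          (∫ q in shell h L, (dz fθ q)^2)
              ≤ C * h ^ (-(1:ℝ)/2) * (∫ q in shell h L, eSq fr fθ fz q) ∧
          (∫ q in shell h L, (dz fr q)^2)
              ≤ C * h ^ (-(1:ℝ)) * (∫ q in shell h L, eSq fr fθ fz q) := by
  intro L hL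
  obtain ⟨K, hK, hs⟩ := shell_scalings L
  refine ⟨2 * K, 1 / 25, by linarith, by norm_num, ?_⟩
  intro h hh hh1 u v w hu hv hw pu pv pw hbc
  have H := isShellField_of_boundary hL hh hh1.le hu hv hw pu pv pw hbc
  have hE := H.energy_nonneg
  obtain ⟨x, hx, rfl⟩ : ∃ x : ℝ, 0 < x ∧ x ^ 4 = h :=
    ⟨h ^ (1 / 4 : ℝ), by positivity, by rw [← Real.rpow_natCast, ← Real.rpow_mul hh.le]; norm_num⟩
  obtain ⟨b1, b2, b3⟩ := hs x _ u v w hx H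
  have hbox : shell (x ^ 4) L = box L (1 - x ^ 4 / 2) (1 - x ^ 4 / 2 + x ^ 4) := by
    unfold shell box; congr 2; ring
  have hpow : ∀ (n : ℕ) (p : ℝ), 4 * p = -n → (x ^ 4) ^ p = (x ^ n)⁻¹ := fun n p hp => by
    rw [← Real.rpow_natCast x 4, ← Real.rpow_mul hx.le, ← Real.rpow_natCast x n,
      ← Real.rpow_neg hx.le]
    congr 1
  set E := ∫ q in shell (x ^ 4) L, eSq u v w q
  have fin : ∀ {y : ℝ} {n : ℕ}, y * x ^ n ≤ K * E → y ≤ K * (x ^ n)⁻¹ * E := by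
    intro y n hy
    rw [← le_div_iff₀ (by positivity)] at hy
    exact hy.trans_eq (by ring)
  have hKE : ∀ n : ℕ, 0 ≤ K * (x ^ n)⁻¹ * E := fun n =>
    mul_nonneg (mul_nonneg (by linarith) (by positivity)) hE
  rw [hpow 6 _ (by norm_num), hpow 2 _ (by norm_num), hpow 4 _ (by norm_num)]
  refine ⟨?_, ?_, ?_⟩
  · have cut := (Smooth.dd hu et).cont
    have cv := Smooth.cont hv
    have hr : ∀ q ∈ box L (1 - x ^ 4 / 2) (1 - x ^ 4 / 2 + x ^ 4), 49 / 50 ≤ q.1 :=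
      fun q hq => (H.mem_box hq).1
    have h1 : ∫ q in box L (1 - x ^ 4 / 2) (1 - x ^ 4 / 2 + x ^ 4), ((dd et u q - v q) / q.1) ^ 2
        ≤ ∫ q in box L (1 - x ^ 4 / 2) (1 - x ^ 4 / 2 + x ^ 4), 2 * (dd et u q - v q) ^ 2 := by
      refine setIntegral_mono_on
        (ContinuousOn.integrableOn_compact (isCompact_box _ _ _) ?_)
        (ContinuousOn.integrableOn_compact (isCompact_box _ _ _)
          (Continuous.continuousOn (by fun_prop)))
        (isCompact_box _ _ _).measurableSet fun q hq => ?_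
      · have h0 : ∀ q ∈ box L (1 - x ^ 4 / 2) (1 - x ^ 4 / 2 + x ^ 4), q.1 ≠ 0 := fun q hq => by
          linarith [hr q hq]
        fun_prop (disch := assumption)
      · have h0 := hr q hq
        rw [div_pow, div_le_iff₀ (by positivity)]
        nlinarith [mul_nonneg (sq_nonneg (dd et u q - v q)) (by nlinarith : 0 ≤ 2 * q.1 ^ 2 - 1)]
    rw [integral_const_mul] at h1
    rw [hbox]
    refine h1.trans ?_
    have := fin b1
    unfold nsq boxInt at this
    linarith
  · rw [hbox]
    have := fin b2
    unfold nsq boxInt at this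
    have h2 := hKE 2
    exact this.trans (by linarith)
  · rw [hbox]
    have := fin b3
    unfold nsq boxInt at this
    have h2 := hKE 4
    exact this.trans (by linarith)
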